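/- Let k be a field and let A and B be finite-dimensional self-injective k-algebras (i.e. A is injective as a left A-module, and likewise B) having no semisimple direct factors (i.e. there is no nonzero central idempotent e of A such that eA is a semisimple algebra, and likewise for B). If the lower triangular matrix algebras T₂(A) and T₂(B) are stably equivalent of Morita type, then A and B are Morita equivalent. -/

import Mathlib

set_option synthInstance.maxHeartbeats 1000000
set_option maxHeartbeats 1000000

/-- The algebra `T₂(R)` of lower triangular `2 × 2` matrices over an algebra `R`,
as a subalgebra of the full `2 × 2` matrix algebra. -/
def lowerTriangular₂ (k R : Type*) [CommSemiring k] [Semiring R] [Algebra k R] :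
    Subalgebra k (Matrix (Fin 2) (Fin 2) R) where
  carrier := {M | M 0 1 = 0}
  add_mem' := by
    intro M N hM hN
    have hM' : M 0 1 = 0 := hM
    have hN' : N 0 1 = 0 := hN
    show (M + N) 0 1 = 0
    rw [Matrix.add_apply, hM', hN', add_zero]
  mul_mem' := by
    intro M N hM hN
    have hM' : M 0 1 = 0 := hM
    have hN' : N 0 1 = 0 := hN
    show (M * N) 0 1 = 0
    rw [Matrix.mul_apply, Fin.sum_univ_two, hM', hN', mul_zero, zero_mul, add_zero]
  algebraMap_mem' := by
    intro c
    show (algebraMap k (Matrix (Fin 2) (Fin 2) R) c) 0 1 = 0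
    rw [Matrix.algebraMap_eq_diagonal]
    exact Matrix.diagonal_apply_ne _ (by decide)

universe u v w

open TensorProduct MulOpposite in
/-- The subgroup of relations defining the tensor product `M ⊗_B N` over `B` inside
`M ⊗_ℤ N`, where `M` is an `(A,B)`-bimodule and `N` a `(B,C)`-bimodule (bimodules are
modules over the corresponding enveloping algebras `A ⊗ₖ Bᵒᵖ`, resp. `B ⊗ₖ Cᵒᵖ`). -/
noncomputable def balancedRel (k A B C : Type*) [Field k] [Ring A] [Ring B] [Ring C]
    [Algebra k A] [Algebra k B] [Algebra k C]
    (M N : Type*) [AddCommGroup M] [AddCommGroup N]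
    [Module (A ⊗[k] Bᵐᵒᵖ) M] [Module (B ⊗[k] Cᵐᵒᵖ) N] : Submodule ℤ (M ⊗[ℤ] N) :=
  Submodule.span ℤ
    {x | ∃ (m : M) (b : B) (n : N),
      x = ((((1 : A) ⊗ₜ[k] op b) • m) ⊗ₜ[ℤ] n) - (m ⊗ₜ[ℤ] ((b ⊗ₜ[k] (1 : Cᵐᵒᵖ)) • n))}

open TensorProduct MulOpposite in
/-- The tensor product `M ⊗_B N` over `B` of an `(A,B)`-bimodule `M` and a
`(B,C)`-bimodule `N`, realized as the quotient of `M ⊗_ℤ N` by the balancing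
relations. -/
noncomputable abbrev OverTensor (k A B C : Type*) [Field k] [Ring A] [Ring B] [Ring C]
    [Algebra k A] [Algebra k B] [Algebra k C]
    (M N : Type*) [AddCommGroup M] [AddCommGroup N]
    [Module (A ⊗[k] Bᵐᵒᵖ) M] [Module (B ⊗[k] Cᵐᵒᵖ) N] :=
  (M ⊗[ℤ] N) ⧸ balancedRel k A B C M N

open TensorProduct MulOpposite in
/-- A witness for a stable equivalence of Morita type between `k`-algebras `A` and `B`
(Broué): bimodules `AMB` and `BNA`, projective as one-sided modules on either side,
together with bimodule isomorphisms `M ⊗_B N ≅ A ⊕ P` and `N ⊗_A M ≅ B ⊕ Q`, where `P`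
and `Q` are projective bimodules.  Bimodules are modules over the enveloping algebras,
and the bimodule isomorphisms are encoded as additive isomorphisms which are equivariant
for the left and right actions (stated on generators of the tensor products). -/
structure StableMoritaWitness (k : Type u) (A : Type v) (B : Type w)
    [Field k] [Ring A] [Ring B] [Algebra k A] [Algebra k B] where
  M : Type (max u v w)
  N : Type (max u v w)
  P : Type (max u v w)
  Q : Type (max u v w)
  [addM : AddCommGroup M]
  [addN : AddCommGroup N]
  [addP : AddCommGroup P]
  [addQ : AddCommGroup Q]
  [modM : Module (A ⊗[k] Bᵐᵒᵖ) M]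
  [modN : Module (B ⊗[k] Aᵐᵒᵖ) N]
  [modP : Module (A ⊗[k] Aᵐᵒᵖ) P]
  [modQ : Module (B ⊗[k] Bᵐᵒᵖ) Q]
  projM_left :
    letI : Module A M :=
      Module.compHom M (Algebra.TensorProduct.includeLeftRingHom (R := k) (A := A) (B := Bᵐᵒᵖ))
    Module.Projective A M
  projM_right :
    letI : Module Bᵐᵒᵖ M :=
      Module.compHom M (Algebra.TensorProduct.includeRight (R := k) (A := A) (B := Bᵐᵒᵖ)).toRingHom
    Module.Projective Bᵐᵒᵖ M
  projN_left :
    letI : Module B N :=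
      Module.compHom N (Algebra.TensorProduct.includeLeftRingHom (R := k) (A := B) (B := Aᵐᵒᵖ))
    Module.Projective B N
  projN_right :
    letI : Module Aᵐᵒᵖ N :=
      Module.compHom N (Algebra.TensorProduct.includeRight (R := k) (A := B) (B := Aᵐᵒᵖ)).toRingHom
    Module.Projective Aᵐᵒᵖ N
  projP : Module.Projective (A ⊗[k] Aᵐᵒᵖ) P
  projQ : Module.Projective (B ⊗[k] Bᵐᵒᵖ) Q
  theta : OverTensor k A B A M N ≃+ A × P
  theta_left : ∀ (a : A) (m : M) (n : N),
    theta (Submodule.Quotient.mk (((a ⊗ₜ[k] (1 : Bᵐᵒᵖ)) • m) ⊗ₜ[ℤ] n)) =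
      (a * (theta (Submodule.Quotient.mk (m ⊗ₜ[ℤ] n))).1,
        (a ⊗ₜ[k] (1 : Aᵐᵒᵖ)) • (theta (Submodule.Quotient.mk (m ⊗ₜ[ℤ] n))).2)
  theta_right : ∀ (a : A) (m : M) (n : N),
    theta (Submodule.Quotient.mk (m ⊗ₜ[ℤ] (((1 : B) ⊗ₜ[k] op a) • n))) =
      ((theta (Submodule.Quotient.mk (m ⊗ₜ[ℤ] n))).1 * a,
        ((1 : A) ⊗ₜ[k] op a) • (theta (Submodule.Quotient.mk (m ⊗ₜ[ℤ] n))).2)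
  eta : OverTensor k B A B N M ≃+ B × Q
  eta_left : ∀ (b : B) (n : N) (m : M),
    eta (Submodule.Quotient.mk (((b ⊗ₜ[k] (1 : Aᵐᵒᵖ)) • n) ⊗ₜ[ℤ] m)) =
      (b * (eta (Submodule.Quotient.mk (n ⊗ₜ[ℤ] m))).1,
        (b ⊗ₜ[k] (1 : Bᵐᵒᵖ)) • (eta (Submodule.Quotient.mk (n ⊗ₜ[ℤ] m))).2)
  eta_right : ∀ (b : B) (n : N) (m : M),
    eta (Submodule.Quotient.mk (n ⊗ₜ[ℤ] (((1 : A) ⊗ₜ[k] op b) • m))) =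
      ((eta (Submodule.Quotient.mk (n ⊗ₜ[ℤ] m))).1 * b,
        ((1 : B) ⊗ₜ[k] op b) • (eta (Submodule.Quotient.mk (n ⊗ₜ[ℤ] m))).2)

/-- Two `k`-algebras are *stably equivalent of Morita type* if there is a witness as
above. -/
def IsStablyEquivalentOfMoritaType (k : Type u) (A : Type v) (B : Type w)
    [Field k] [Ring A] [Ring B] [Algebra k A] [Algebra k B] : Prop :=
  Nonempty (StableMoritaWitness k A B)

/-- For a central idempotent `e` of `A`, the factor `eA` of `A`, realized as the quotient
of `A` by the two-sided ideal generated by `1 - e`. -/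
def cornerFactor (A : Type*) [Ring A] (e : A) : Type _ :=
  (TwoSidedIdeal.span {1 - e}).ringCon.Quotient

noncomputable instance (A : Type*) [Ring A] (e : A) : Ring (cornerFactor A e) :=
  inferInstanceAs (Ring (TwoSidedIdeal.span {1 - e}).ringCon.Quotient)

/-- A ring `A` has no semisimple (direct) factor if there is no nonzero central
idempotent `e` of `A` such that the factor `eA` of `A` is a semisimple ring. -/
def HasNoSemisimpleFactor (A : Type*) [Ring A] : Prop :=
  ∀ e : A, IsIdempotentElem e → e ∈ Set.center A → e ≠ 0 →
    ¬ IsSemisimpleRing (cornerFactor A e)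

theorem Module.Projective.finsupp {R P : Type*} (ι : Type*) [Ring R] [AddCommGroup P] [Module R P]
    [Module.Projective R P] : Module.Projective R (ι →₀ P) := by
  classical
  exact .of_equiv (finsuppLequivDFinsupp (ι := ι) (M := P) R).symm

section SelfInjective

variable {A : Type u} [Ring A]

theorem Module.Injective.exists_extension_of_ker_le {Q X Y : Type u} [AddCommGroup Q] [Module A Q]
    [AddCommGroup X] [Module A X] [AddCommGroup Y] [Module A Y] [Module.Injective A Q]
    (f : X →ₗ[A] Y) (h : X →ₗ[A] Q) (hfh : ∀ x, f x = 0 → h x = 0) :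
    ∃ g : Y →ₗ[A] Q, ∀ x, g (f x) = h x := by
  obtain ⟨g, hg⟩ := Module.Injective.out (R := A) (Q := Q)
    ((LinearMap.ker f).liftQ f le_rfl)
    (LinearMap.ker_eq_bot.1 (Submodule.ker_liftQ_eq_bot _ _ _ le_rfl))
    ((LinearMap.ker f).liftQ h fun x hx => hfh x hx)
  exact ⟨g, fun x => hg (Submodule.Quotient.mk x)⟩

theorem Module.Injective.of_retract {P Q : Type u} [AddCommGroup P] [Module A P]
    [AddCommGroup Q] [Module A Q] [Module.Injective A Q]
    (i : P →ₗ[A] Q) (r : Q →ₗ[A] P) (hri : ∀ x, r (i x) = x) : Module.Injective A P where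
  out X Y _ _ _ _ f hf g := by
    obtain ⟨h, hh⟩ := Module.Injective.out (R := A) (Q := Q) f hf (i ∘ₗ g)
    exact ⟨r ∘ₗ h, fun x => by simp [hh, hri]⟩

/-- If an endomorphism `φ` of a semilattice satisfying the descending chain condition has a
right inverse, then `⊤` is the only element which `φ` maps to `⊤`. -/
theorem eq_top_of_map_eq_top {L : Type*} [SemilatticeInf L] [OrderTop L] [WellFoundedLT L]
    (φ ψ : L → L) (hφψ : ∀ x, φ (ψ x) = x) (hφ : ∀ x y, φ (x ⊓ y) = φ x ⊓ φ y)
    (T : L) (hT : φ T = ⊤) : T = ⊤ := by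
  have hmono : Monotone φ := fun x y hxy => by
    rw [← inf_eq_left, ← hφ, inf_eq_left.2 hxy]
  have htop : φ ⊤ = ⊤ := top_le_iff.1 (by simpa [hφψ] using hmono (le_top : ψ ⊤ ≤ ⊤))
  have hmonon : ∀ n, Monotone φ^[n] := fun n => hmono.iterate n
  have htopn : ∀ n, φ^[n] ⊤ = ⊤ := fun n => Function.iterate_fixed htop n
  have hinf : ∀ n x y, φ^[n] (x ⊓ y) = φ^[n] x ⊓ φ^[n] y := by
    intro n
    induction n with
    | zero => simp
    | succ n ih => intro x y; simp only [Function.iterate_succ_apply, hφ, ih]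
  have hle : ∀ n m x, n ≤ m → φ^[n] x = ⊤ → φ^[m] x = ⊤ := by
    intro n m x hnm hx
    obtain ⟨d, rfl⟩ := Nat.exists_eq_add_of_le' hnm
    rw [Function.iterate_add_apply, hx, htopn]
  obtain ⟨S, ⟨n, hn⟩, hmin⟩ := wellFounded_lt.has_min {x : L | ∃ n, φ^[n] x = ⊤} ⟨⊤, 0, rfl⟩
  have hleast : ∀ m x, φ^[m] x = ⊤ → S ≤ x := by
    intro m x hx
    by_contra hSx
    refine hmin (S ⊓ x) ⟨max n m, ?_⟩ (lt_of_le_of_ne inf_le_left fun h => hSx (inf_eq_left.1 h))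
    rw [hinf, hle n _ _ (le_max_left _ _) hn, hle m _ _ (le_max_right _ _) hx, inf_top_eq]
  have hψn : φ^[n] (ψ^[n] T) = T := (Function.LeftInverse.iterate (f := ψ) (g := φ) hφψ n) T
  have h1 : S ≤ ψ^[n] T := hleast (n + 1) _ (by rw [Function.iterate_succ_apply', hψn, hT])
  have h2 := hmonon n h1
  rwa [hn, hψn, top_le_iff] at h2

namespace TwoSidedIdeal

/-- The two-sided ideal of elements annihilated on the left by a two-sided ideal. -/
def rightAnnihilator (T : TwoSidedIdeal A) : TwoSidedIdeal A :=
  .mk' {a | ∀ x ∈ T, x * a = 0} (fun x _ => mul_zero x)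
    (fun ha hb x hx => by rw [mul_add, ha x hx, hb x hx, add_zero])
    (fun ha x hx => by rw [mul_neg, ha x hx, neg_zero])
    (fun {c _} ha x hx => by rw [← mul_assoc]; exact ha _ (T.mul_mem_right x c hx))
    (fun ha x hx => by rw [← mul_assoc, ha x hx, zero_mul])

/-- The two-sided ideal of elements annihilated on the right by a two-sided ideal. -/
def leftAnnihilator (T : TwoSidedIdeal A) : TwoSidedIdeal A :=
  .mk' {a | ∀ x ∈ T, a * x = 0} (fun x _ => zero_mul x)
    (fun ha hb x hx => by rw [add_mul, ha x hx, hb x hx, add_zero])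
    (fun ha x hx => by rw [neg_mul, ha x hx, neg_zero])
    (fun ha x hx => by rw [mul_assoc, ha x hx, mul_zero])
    (fun {_ c} ha x hx => by rw [mul_assoc]; exact ha _ (T.mul_mem_left c x hx))

theorem mem_rightAnnihilator {T : TwoSidedIdeal A} {a : A} :
    a ∈ T.rightAnnihilator ↔ ∀ x ∈ T, x * a = 0 :=
  mem_mk' ..

theorem mem_leftAnnihilator {T : TwoSidedIdeal A} {a : A} :
    a ∈ T.leftAnnihilator ↔ ∀ x ∈ T, a * x = 0 :=
  mem_mk' ..

instance [IsArtinianRing A] : WellFoundedLT (TwoSidedIdeal A) :=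
  StrictMono.wellFoundedLT (f := TwoSidedIdeal.asIdeal (R := A))
    (asIdeal.monotone.strictMono_of_injective fun I J h =>
      TwoSidedIdeal.ext fun x => by rw [← mem_asIdeal, h, mem_asIdeal])

variable [Module.Injective A A]

theorem exists_add_of_mem_rightAnnihilator_inf {S T : TwoSidedIdeal A} {c : A}
    (hc : c ∈ (S ⊓ T).rightAnnihilator) :
    ∃ a ∈ S.rightAnnihilator, ∃ b ∈ T.rightAnnihilator, a + b = c := by
  rw [mem_rightAnnihilator] at hc
  obtain ⟨g, hg⟩ := Module.Injective.exists_extension_of_ker_le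
    (T.asIdeal.mkQ ∘ₗ S.asIdeal.subtype)
    (LinearMap.toSpanSingleton A A c ∘ₗ S.asIdeal.subtype) fun x hx =>
      hc x ⟨mem_asIdeal.1 x.2, mem_asIdeal.1 ((Submodule.Quotient.mk_eq_zero _).1 hx)⟩
  have hmk : ∀ x, g (T.asIdeal.mkQ x) = x * g (T.asIdeal.mkQ 1) := fun x => by
    rw [← smul_eq_mul, ← map_smul, ← map_smul, smul_eq_mul, mul_one]
  refine ⟨c - g (T.asIdeal.mkQ 1), mem_rightAnnihilator.2 fun x hx => ?_, g (T.asIdeal.mkQ 1),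
    mem_rightAnnihilator.2 fun x hx => ?_, sub_add_cancel _ _⟩
  · rw [mul_sub, ← hmk, sub_eq_zero]
    exact (hg ⟨x, mem_asIdeal.2 hx⟩).symm
  · rw [← hmk, Submodule.mkQ_apply,
      (Submodule.Quotient.mk_eq_zero _).2 (mem_asIdeal.2 hx), map_zero]

theorem rightAnnihilator_leftAnnihilator (k : Type u) [Field k] [Algebra k A]
    [FiniteDimensional k A] (T : TwoSidedIdeal A) :
    T.leftAnnihilator.rightAnnihilator = T := by
  refine le_antisymm (fun b hb => ?_)
    (fun b hb => mem_rightAnnihilator.2 fun x hx => mem_leftAnnihilator.1 hx b hb)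
  obtain ⟨n, a, ha⟩ := Submodule.fg_iff_exists_fin_generating_family.1
    (IsNoetherian.noetherian (T.asIdeal.restrictScalars k))
  have hspan : ∀ w, w ∈ Submodule.span k (Set.range a) ↔ w ∈ T := fun w => by
    rw [ha]; exact mem_asIdeal
  have haT : ∀ i, a i ∈ T := fun i => (hspan _).1 (Submodule.subset_span ⟨i, rfl⟩)
  obtain ⟨g, hg⟩ := Module.Injective.exists_extension_of_ker_le
    (LinearMap.pi fun i => LinearMap.toSpanSingleton A A (a i))
    (LinearMap.toSpanSingleton A A b) (fun x hx => by
      refine mem_rightAnnihilator.1 hb x (mem_leftAnnihilator.2 fun y hy => ?_)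
      replace hy := (hspan y).2 hy
      induction hy using Submodule.span_induction with
      | mem y hy => obtain ⟨i, rfl⟩ := hy; exact congrFun hx i
      | zero => exact mul_zero x
      | add y z _ _ h1 h2 => rw [mul_add, h1, h2, add_zero]
      | smul c y _ h1 => rw [mul_smul_comm, h1, smul_zero])
  have hb' := hg 1
  rw [LinearMap.toSpanSingleton_apply, one_smul, LinearMap.pi_apply_eq_sum_univ] at hb'
  rw [← hb']
  exact sum_mem fun i _ => T.mul_mem_right _ _ (by simpa using haT i)

theorem eq_top_of_rightAnnihilator_eq_bot (k : Type u) [Field k] [Algebra k A]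
    [FiniteDimensional k A] (T : TwoSidedIdeal A) (hT : T.rightAnnihilator = ⊥) :
    T = ⊤ := by
  have : IsArtinianRing A := IsArtinianRing.of_finite k A
  have hanti : ∀ {S T : TwoSidedIdeal A}, S ≤ T → T.rightAnnihilator ≤ S.rightAnnihilator :=
    fun h a ha => mem_rightAnnihilator.2 fun x hx => mem_rightAnnihilator.1 ha x (h hx)
  refine eq_top_of_map_eq_top (fun T => T.rightAnnihilator.rightAnnihilator)
    (fun T => T.leftAnnihilator.leftAnnihilator)
    (fun T => ?_) (fun S T => le_antisymm (le_inf ?_ ?_) ?_) T ?_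
  · simp only [rightAnnihilator_leftAnnihilator k]
  · exact hanti (hanti inf_le_left)
  · exact hanti (hanti inf_le_right)
  · rintro x ⟨hx, hx'⟩
    refine mem_rightAnnihilator.2 fun c hc => ?_
    obtain ⟨a, ha, b, hb, rfl⟩ := exists_add_of_mem_rightAnnihilator_inf hc
    rw [add_mul, mem_rightAnnihilator.1 hx a ha, mem_rightAnnihilator.1 hx' b hb, add_zero]
  · refine top_le_iff.1 fun a _ => mem_rightAnnihilator.2 fun x hx => ?_
    rw [hT, mem_bot] at hx
    rw [hx, zero_mul]

end TwoSidedIdeal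
end SelfInjective

section QuasiFrobenius

open TensorProduct

variable {A : Type u} [Ring A]

theorem Ideal.exists_ne_zero_forall_mul_eq_zero (k : Type u) [Field k] [Algebra k A]
    [FiniteDimensional k A] [Module.Injective A A] (m : Ideal A)
    (hm : m ≠ ⊤) : ∃ d : A, d ≠ 0 ∧ ∀ x ∈ m, x * d = 0 := by
  let T : TwoSidedIdeal A := .mk' {b | ∀ c, b * c ∈ m} (fun c => by simp)
    (fun ha hb c => by rw [add_mul]; exact m.add_mem (ha c) (hb c))
    (fun ha c => by rw [neg_mul]; exact m.neg_mem (ha c))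
    (fun ha c => by rw [mul_assoc]; exact m.mul_mem_left _ (ha c))
    (fun ha c => by rw [mul_assoc]; exact ha _)
  have hT : ∀ {b}, b ∈ T ↔ ∀ c, b * c ∈ m := TwoSidedIdeal.mem_mk' ..
  have hTtop : T ≠ ⊤ := fun h => hm <| (Ideal.eq_top_iff_one m).2 <| by
    simpa using hT.1 (h ▸ (TwoSidedIdeal.mem_top A : (1 : A) ∈ _)) 1
  obtain ⟨a, ha, ha0⟩ : ∃ a ∈ T.rightAnnihilator, a ≠ 0 := by
    by_contra! h
    exact hTtop (T.eq_top_of_rightAnnihilator_eq_bot k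
      (bot_unique fun a ha => (TwoSidedIdeal.mem_bot A).2 (h a ha)))
  let b := Module.finBasis k A
  obtain ⟨g, hg⟩ := Module.Injective.exists_extension_of_ker_le
    (LinearMap.pi fun i => m.mkQ ∘ₗ LinearMap.toSpanSingleton A A (b i))
    (LinearMap.toSpanSingleton A A a) (fun x hx => by
      refine TwoSidedIdeal.mem_rightAnnihilator.1 ha x (hT.2 fun c => ?_)
      rw [← b.sum_repr c, Finset.mul_sum]
      refine m.sum_mem fun i _ => ?_
      rw [mul_smul_comm, Algebra.smul_def]
      exact m.mul_mem_left _ ((Submodule.Quotient.mk_eq_zero _).1 (congrFun hx i)))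
  by_contra! h
  have hgi : ∀ i, g ∘ₗ LinearMap.single A _ i = 0 := by
    intro i
    have h1 : g (Pi.single i (m.mkQ 1)) = 0 := by
      by_contra hne
      obtain ⟨x, hx, hxd⟩ := h _ hne
      refine hxd ?_
      rw [← smul_eq_mul, ← map_smul, ← Pi.single_smul, ← map_smul, smul_eq_mul, mul_one,
        Submodule.mkQ_apply, (Submodule.Quotient.mk_eq_zero _).2 hx, Pi.single_zero, map_zero]
    refine LinearMap.ext fun y => ?_
    obtain ⟨c, rfl⟩ := m.mkQ_surjective y
    have h2 := congrArg (c • ·) h1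
    rwa [← map_smul, ← Pi.single_smul, ← map_smul, smul_eq_mul, mul_one, smul_zero] at h2
  have hg0 : g = 0 := LinearMap.pi_ext' hgi
  have := hg 1
  rw [LinearMap.toSpanSingleton_apply, one_smul, hg0] at this
  exact ha0 this.symm

theorem Module.exists_linearMap_apply_ne_zero (k : Type u) [Field k] [Algebra k A]
    [FiniteDimensional k A] [Module.Injective A A] {K : Type u}
    [AddCommGroup K] [Module A K] {x : K} (hx : x ≠ 0) : ∃ g : K →ₗ[A] A, g x ≠ 0 := by
  obtain ⟨d, hd, hxd⟩ := Ideal.exists_ne_zero_forall_mul_eq_zero k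
    (LinearMap.ker (LinearMap.toSpanSingleton A K x))
    (fun h => hx (by simpa using (Ideal.eq_top_iff_one _).1 h))
  obtain ⟨g, hg⟩ := Module.Injective.exists_extension_of_ker_le
    (LinearMap.toSpanSingleton A K x) (LinearMap.toSpanSingleton A A d) hxd
  refine ⟨g, ?_⟩
  have := hg 1
  simp only [LinearMap.toSpanSingleton_apply, one_smul] at this
  rwa [this]

/-- For a finite-dimensional algebra `A`, arbitrary powers of `A` are extended from `k`. -/
noncomputable def tensorFunEquiv (k : Type u) [Field k] (A : Type u) [Ring A] [Algebra k A]
    [FiniteDimensional k A] (S : Type u) : A ⊗[k] (S → k) ≃ₗ[A] (S → A) :=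
  let b := Module.finBasis k A
  let e : A ⊗[k] (S → k) ≃ₗ[k] (S → A) :=
    TensorProduct.equivFinsuppOfBasisLeft b ≪≫ₗ Finsupp.linearEquivFunOnFinite k _ _ ≪≫ₗ
      { toFun := fun f s => b.equivFun.symm fun i => f i s
        invFun := fun g i s => b.equivFun (g s) i
        map_add' := fun f g => funext fun s => map_add b.equivFun.symm (f · s) (g · s)
        map_smul' := fun c f => funext fun s => map_smul b.equivFun.symm c (f · s)
        left_inv := fun f => funext fun i => funext fun s =>
          congrFun (b.equivFun.apply_symm_apply (f · s)) i
        right_inv := fun g => funext fun s => b.equivFun.symm_apply_apply (g s) }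
  have he : ∀ a w, e (a ⊗ₜ w) = fun s => w s • a := fun a w => by
    funext s
    have : (fun i => b.repr a i * w s) = w s • b.equivFun a := by
      funext i
      simp [mul_comm]
    simpa [e, this, -Module.Basis.equivFun_symm_apply] using
      congrArg (w s • ·) (b.equivFun.symm_apply_apply a)
  { e with
    map_smul' := fun a t => by
      change e (a • t) = a • e t
      induction t with
      | zero => simp
      | tmul c w => rw [TensorProduct.smul_tmul', he, he]; funext s; simp
      | add x y hx hy => rw [smul_add, map_add, hx, hy, map_add, smul_add] }

theorem Module.Injective.of_projective (k : Type u) [Field k] [Algebra k A]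
    [FiniteDimensional k A] [Module.Injective A A] (P : Type u) [AddCommGroup P] [Module A P]
    [Module.Projective A P] : Module.Injective A P := by
  classical
  have hfun : Module.Injective A (A ⊗[k] (P → k)) :=
    .of_retract (tensorFunEquiv k A P).toLinearMap (tensorFunEquiv k A P).symm.toLinearMap (by simp)
  obtain ⟨r, hr⟩ := (Finsupp.lcoeFun : (P →₀ k) →ₗ[k] (P → k)).exists_leftInverse_of_injective
    (LinearMap.ker_eq_bot.2 DFunLike.coe_injective)
  have hten : Module.Injective A (A ⊗[k] (P →₀ k)) :=
    .of_retract (LinearMap.baseChange A Finsupp.lcoeFun) (r.baseChange A) fun x => by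
      rw [← LinearMap.comp_apply, ← LinearMap.baseChange_comp, hr, LinearMap.baseChange_id,
        LinearMap.id_apply]
  have hfree : Module.Injective A (P →₀ A) :=
    .of_retract (TensorProduct.finsuppScalarRight k A A P).symm.toLinearMap
      (TensorProduct.finsuppScalarRight k A A P).toLinearMap (by simp)
  obtain ⟨s, hs⟩ := (Module.projective_def (R := A) (P := P)).1 inferInstance
  exact .of_retract s _ hs

theorem Module.exists_injective_linearMap_projective (k : Type u) [Field k] [Algebra k A]
    [FiniteDimensional k A] [Module.Injective A A] (K : Type u) [AddCommGroup K] [Module A K] :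
    ∃ (P : Type u) (_ : AddCommGroup P) (_ : Module A P) (_ : Module.Projective A P)
      (i : K →ₗ[A] P), Function.Injective i := by
  have hproj : Module.Projective A ((K →ₗ[A] A) → A) :=
    .of_equiv (tensorFunEquiv k A (K →ₗ[A] A))
  refine ⟨(K →ₗ[A] A) → A, inferInstance, inferInstance, hproj, LinearMap.pi fun g => g, ?_⟩
  refine (injective_iff_map_eq_zero _).2 fun x hx => ?_
  by_contra hne
  obtain ⟨g, hg⟩ := Module.exists_linearMap_apply_ne_zero k (A := A) hne
  exact hg (congrFun hx g)

end QuasiFrobenius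

namespace LowerTriangular

variable (k : Type u) [Field k] {A : Type u} [Ring A] [Algebra k A]

/-- The diagonal embedding of `A` into the algebra of lower triangular matrices over `A`. -/
def diag : A →+* lowerTriangular₂ k A where
  toFun a := ⟨Matrix.diagonal fun _ => a, rfl⟩
  map_one' := Subtype.ext Matrix.diagonal_one
  map_mul' _ _ := Subtype.ext (Matrix.diagonal_mul_diagonal _ _).symm
  map_zero' := Subtype.ext Matrix.diagonal_zero
  map_add' _ _ := Subtype.ext (Matrix.diagonal_add _ _).symm

variable (A) in
/-- The matrix unit in position `(0, 0)`. -/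
def unitE : lowerTriangular₂ k A := ⟨!![1, 0; 0, 0], rfl⟩

variable (A) in
/-- The matrix unit in position `(1, 0)`. -/
def unitT : lowerTriangular₂ k A := ⟨!![0, 0; 1, 0], rfl⟩

variable {k}

theorem ext_entries {l m : lowerTriangular₂ k A} (h00 : l.1 0 0 = m.1 0 0)
    (h10 : l.1 1 0 = m.1 1 0) (h11 : l.1 1 1 = m.1 1 1) : l = m := by
  refine Subtype.ext (Matrix.ext fun i j => ?_)
  fin_cases i <;> fin_cases j
  exacts [h00, l.2.trans m.2.symm, h10, h11]

instance : Module A (lowerTriangular₂ k A) := Module.compHom _ (diag k)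

theorem smul_eq (a : A) (l : lowerTriangular₂ k A) : a • l = diag k a * l := rfl

instance : IsScalarTower A (lowerTriangular₂ k A) (lowerTriangular₂ k A) :=
  ⟨fun a l m => mul_assoc (diag k a) l m⟩

@[simp] theorem smul_entry (a : A) (l : lowerTriangular₂ k A) (i j : Fin 2) :
    (a • l).1 i j = a * l.1 i j :=
  Matrix.diagonal_mul _ _ _ _

theorem mul_entry (l m : lowerTriangular₂ k A) (i j : Fin 2) :
    (l * m).1 i j = l.1 i 0 * m.1 0 j + l.1 i 1 * m.1 1 j :=
  (Matrix.mul_apply ..).trans (Fin.sum_univ_two _)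

theorem unitE_mul_self : unitE k A * unitE k A = unitE k A := by
  apply ext_entries <;> simp [mul_entry, unitE]

theorem unitT_mul_unitE : unitT k A * unitE k A = unitT k A := by
  apply ext_entries <;> simp [mul_entry, unitE, unitT]

theorem unitE_mul_unitT : unitE k A * unitT k A = 0 := by
  apply ext_entries <;> simp [mul_entry, unitE, unitT]

theorem unitT_mul_self : unitT k A * unitT k A = 0 := by
  apply ext_entries <;> simp [mul_entry, unitT]

theorem commute_diag_unitE (a : A) : Commute (diag k a) (unitE k A) := by
  apply ext_entries <;> simp [mul_entry, unitE, diag]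

theorem commute_diag_unitT (a : A) : Commute (diag k a) (unitT k A) := by
  apply ext_entries <;> simp [mul_entry, unitT, diag]

theorem eq_sum_entries (l : lowerTriangular₂ k A) :
    l = l.1 0 0 • unitE k A + l.1 1 0 • unitT k A + l.1 1 1 • (1 - unitE k A) := by
  apply ext_entries <;> simp [unitE, unitT]

instance : Module.Projective A (lowerTriangular₂ k A) := by
  let f : lowerTriangular₂ k A →ₗ[A] A × A × A :=
    { toFun := fun l => (l.1 0 0, l.1 1 0, l.1 1 1)
      map_add' := fun _ _ => rfl
      map_smul' := fun a l => by simp }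
  let g : A × A × A →ₗ[A] lowerTriangular₂ k A :=
    LinearMap.coprod (LinearMap.toSpanSingleton A _ (unitE k A))
      (LinearMap.coprod (LinearMap.toSpanSingleton A _ (unitT k A))
        (LinearMap.toSpanSingleton A _ (1 - unitE k A)))
  refine .of_split f g (LinearMap.ext fun l => ?_)
  conv_rhs => rw [LinearMap.id_apply, eq_sum_entries l, add_assoc]
  rfl

section MatrixUnits

variable {X : Type u} [AddCommGroup X] [Module (lowerTriangular₂ k A) X]

theorem unitE_smul_unitE (x : X) : unitE k A • unitE k A • x = unitE k A • x := by
  rw [smul_smul, unitE_mul_self]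

theorem unitT_smul_unitE (x : X) : unitT k A • unitE k A • x = unitT k A • x := by
  rw [smul_smul, unitT_mul_unitE]

theorem unitE_smul_unitT (x : X) : unitE k A • unitT k A • x = 0 := by
  rw [smul_smul, unitE_mul_unitT, zero_smul]

theorem unitT_smul_unitT (x : X) : unitT k A • unitT k A • x = 0 := by
  rw [smul_smul, unitT_mul_self, zero_smul]

end MatrixUnits

section Modules

variable {X Y Z : Type u} [AddCommGroup X] [Module A X] [Module (lowerTriangular₂ k A) X]
  [IsScalarTower A (lowerTriangular₂ k A) X]
  [AddCommGroup Y] [Module A Y] [Module (lowerTriangular₂ k A) Y]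
  [IsScalarTower A (lowerTriangular₂ k A) Y]
  [AddCommGroup Z] [Module A Z] [Module (lowerTriangular₂ k A) Z]
  [IsScalarTower A (lowerTriangular₂ k A) Z]

theorem diag_smul (a : A) (x : X) : diag k a • x = a • x := by
  have h := smul_assoc a (1 : lowerTriangular₂ k A) x
  rwa [smul_eq, mul_one, one_smul] at h

variable (k A X) in
/-- The action of the matrix unit `unitE`. -/
def actE : X →ₗ[A] X where
  toFun x := unitE k A • x
  map_add' := smul_add _
  map_smul' a x := by
    rw [RingHom.id_apply, ← diag_smul (k := k) a x, ← diag_smul (k := k) a (unitE k A • x),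
      smul_smul, smul_smul, (commute_diag_unitE a).eq]

variable (k A X) in
/-- The action of the matrix unit `unitT`. -/
def actT : X →ₗ[A] X where
  toFun x := unitT k A • x
  map_add' := smul_add _
  map_smul' a x := by
    rw [RingHom.id_apply, ← diag_smul (k := k) a x, ← diag_smul (k := k) a (unitT k A • x),
      smul_smul, smul_smul, (commute_diag_unitT a).eq]

@[simp] theorem actE_apply (x : X) : actE k A X x = unitE k A • x := rfl

@[simp] theorem actT_apply (x : X) : actT k A X x = unitT k A • x := rfl

/-- An `A`-linear map commuting with the matrix units is linear over triangular matrices. -/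
def linearMapOfCommute (f : X →ₗ[A] Y) (hE : ∀ x, f (unitE k A • x) = unitE k A • f x)
    (hT : ∀ x, f (unitT k A • x) = unitT k A • f x) : X →ₗ[lowerTriangular₂ k A] Y where
  toFun := f
  map_add' := map_add f
  map_smul' l x := by
    rw [RingHom.id_apply, eq_sum_entries l]
    simp only [add_smul, sub_smul, smul_assoc, one_smul, map_add, map_sub, map_smul, hE, hT]

@[simp] theorem linearMapOfCommute_apply (f : X →ₗ[A] Y) (hE hT) (x : X) :
    linearMapOfCommute (k := k) f hE hT x = f x := rfl

variable (k A X) in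
/-- A module over lower triangular matrices is a linear map between two `A`-modules; this is the
kernel of that map. -/
def kern : Submodule A X where
  carrier := {x | unitE k A • x = x ∧ unitT k A • x = 0}
  add_mem' := fun hx hy => ⟨by rw [smul_add, hx.1, hy.1], by rw [smul_add, hx.2, hy.2, add_zero]⟩
  zero_mem' := ⟨smul_zero _, smul_zero _⟩
  smul_mem' := fun a x hx => ⟨by rw [← actE_apply, map_smul, actE_apply, hx.1],
    by rw [← actT_apply, map_smul, actT_apply, hx.2, smul_zero]⟩

theorem unitE_smul_mem_kern {x : X} (hx : unitT k A • x = 0) : unitE k A • x ∈ kern k A X :=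
  ⟨unitE_smul_unitE x, by rw [unitT_smul_unitE, hx]⟩

theorem map_mem_kern (f : X →ₗ[lowerTriangular₂ k A] Y) {x : X} (hx : x ∈ kern k A X) :
    f x ∈ kern k A Y :=
  ⟨by rw [← map_smul, hx.1], by rw [← map_smul, hx.2, map_zero]⟩

/-- The map induced on kernels by a map of modules over lower triangular matrices. -/
def kernMap (f : X →ₗ[lowerTriangular₂ k A] Y) : kern k A X →ₗ[A] kern k A Y :=
  (f.restrictScalars A).restrict fun _ hx => map_mem_kern f hx

@[simp] theorem coe_kernMap (f : X →ₗ[lowerTriangular₂ k A] Y) (x : kern k A X) :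
    (kernMap f x : Y) = f x := rfl

theorem eq_zero_of_mem_kern_projective [Module.Projective (lowerTriangular₂ k A) X] {x : X}
    (hx : x ∈ kern k A X) : x = 0 := by
  obtain ⟨s, hs⟩ := (Module.projective_def (R := lowerTriangular₂ k A) (P := X)).1 inferInstance
  rw [← hs x]
  suffices s x = 0 by rw [this, map_zero]
  ext1 y
  have hE : unitE k A • s x = s x := by rw [← map_smul, hx.1]
  have hT : unitT k A • s x = 0 := by rw [← map_smul, hx.2, map_zero]
  replace hE := DFunLike.congr_fun hE y
  replace hT := DFunLike.congr_fun hT y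
  generalize s x = w at hE hT
  rw [Finsupp.smul_apply, smul_eq_mul] at hE hT
  have h1 := fun i j => congrFun (congrFun (congrArg Subtype.val hE) i) j
  have h2 := fun i j => congrFun (congrFun (congrArg Subtype.val hT) i) j
  simp only [mul_entry] at h1 h2
  refine ext_entries ?_ ?_ ?_
  · simpa [unitT] using h2 1 0
  · simpa [unitE] using (h1 1 0).symm
  · simpa [unitE] using (h1 1 1).symm

variable (k) in
theorem projective_of_projective [Module.Projective (lowerTriangular₂ k A) X] :
    Module.Projective A X := by
  obtain ⟨s, hs⟩ := (Module.projective_def (R := lowerTriangular₂ k A) (P := X)).1 inferInstance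
  have := Module.Projective.finsupp (R := A) (P := lowerTriangular₂ k A) X
  exact .of_split (s.restrictScalars A)
    ((Finsupp.linearCombination (lowerTriangular₂ k A) id).restrictScalars A) (LinearMap.ext hs)

theorem exists_lift_of_forall_mem_kern [Module.Injective A Y]
    (f : X →ₗ[lowerTriangular₂ k A] Y) (hf : ∀ x ∈ kern k A X, f x = 0)
    (p : Z →ₗ[lowerTriangular₂ k A] Y) (j : Y →ₗ[A] Z) (hj : ∀ y, p (j y) = y) :
    ∃ g : X →ₗ[lowerTriangular₂ k A] Z, ∀ x, p (g x) = f x := by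
  obtain ⟨s, hs⟩ := Module.Injective.exists_extension_of_ker_le (actT k A X)
    (f.restrictScalars A ∘ₗ actE k A X) fun x hx => hf _ (unitE_smul_mem_kern hx)
  replace hs : ∀ x, s (unitT k A • x) = unitE k A • f x := fun x => by
    rw [← map_smul]; exact hs x
  let g : X →ₗ[A] Z := actE k A Z ∘ₗ j ∘ₗ s ∘ₗ actT k A X +
    actT k A Z ∘ₗ j ∘ₗ s ∘ₗ (LinearMap.id - actE k A X) +
    (LinearMap.id - actE k A Z) ∘ₗ j ∘ₗ (f.restrictScalars A - actT k A Y ∘ₗ s) ∘ₗ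
      (LinearMap.id - actE k A X)
  refine ⟨linearMapOfCommute g (fun x => ?_) fun x => ?_, fun x => ?_⟩
  · simp [g, smul_sub, smul_add, unitE_smul_unitE, unitT_smul_unitE, unitE_smul_unitT]
  · simp [g, smul_sub, smul_add, unitT_smul_unitE, unitE_smul_unitT, unitT_smul_unitT, hs]
  · simp [g, smul_sub, unitE_smul_unitE, unitE_smul_unitT, hs, hj]

theorem projective_of_kern_eq_bot [Module.Projective A X] [Module.Injective A X]
    (hX : ∀ x ∈ kern k A X, x = 0) : Module.Projective (lowerTriangular₂ k A) X := by
  let p : (X →₀ lowerTriangular₂ k A) →ₗ[lowerTriangular₂ k A] X :=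
    Finsupp.linearCombination _ id
  obtain ⟨j, hj⟩ := Module.projective_lifting_property (p.restrictScalars A) LinearMap.id
    (Finsupp.linearCombination_id_surjective _ X)
  obtain ⟨g, hg⟩ := exists_lift_of_forall_mem_kern (Z := X →₀ lowerTriangular₂ k A)
    LinearMap.id hX p j fun x =>
    LinearMap.congr_fun hj x
  exact .of_split g p (LinearMap.ext hg)

theorem exists_kernMap_eq [Module.Injective A Y] (φ : kern k A X →ₗ[A] kern k A Y) :
    ∃ f : X →ₗ[lowerTriangular₂ k A] Y, kernMap f = φ := by
  obtain ⟨ψ, hψ⟩ := Module.Injective.exists_extension_of_ker_le (kern k A X).subtype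
    ((kern k A Y).subtype ∘ₗ φ) fun x hx => by
      rw [(kern k A X).injective_subtype (hx.trans (map_zero _).symm), map_zero]
  replace hψ : ∀ x (hx : x ∈ kern k A X), ψ x = φ ⟨x, hx⟩ := fun x hx => hψ ⟨x, hx⟩
  obtain ⟨s, hs⟩ := Module.Injective.exists_extension_of_ker_le (actT k A X)
    (actT k A Y ∘ₗ ψ ∘ₗ actE k A X) fun x hx => by
      have hx' := unitE_smul_mem_kern hx
      change unitT k A • ψ (unitE k A • x) = 0
      rw [hψ _ hx']
      exact (φ ⟨_, hx'⟩).2.2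
  replace hs : ∀ x, s (unitT k A • x) = unitT k A • ψ (unitE k A • x) := hs
  let f : X →ₗ[A] Y := actE k A Y ∘ₗ ψ ∘ₗ actE k A X +
    (LinearMap.id - actE k A Y) ∘ₗ s ∘ₗ (LinearMap.id - actE k A X)
  refine ⟨linearMapOfCommute f (fun x => ?_) fun x => ?_, ?_⟩
  · simp [f, smul_sub, smul_add, unitE_smul_unitE]
  · simp [f, smul_sub, smul_add, unitT_smul_unitE, unitE_smul_unitT, hs]
  · refine LinearMap.ext fun x => Subtype.ext ?_
    rw [coe_kernMap, linearMapOfCommute_apply]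
    simp [f, x.2.1, hψ _ x.2, (φ x).2.1]

end Modules

/-- The module over lower triangular matrices given by a linear map. -/
def OfMap {P Q : Type u} [AddCommGroup P] [Module A P] [AddCommGroup Q] [Module A Q]
    (_ : P →ₗ[A] Q) : Type u := P × Q

namespace OfMap

variable {P Q : Type u} [AddCommGroup P] [Module A P] [AddCommGroup Q] [Module A Q]
  (τ : P →ₗ[A] Q)

instance : AddCommGroup (OfMap τ) := inferInstanceAs (AddCommGroup (P × Q))

instance : Module A (OfMap τ) := inferInstanceAs (Module A (P × Q))

instance [Module.Projective A P] [Module.Projective A Q] : Module.Projective A (OfMap τ) :=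
  inferInstanceAs (Module.Projective A (P × Q))

instance : Module (lowerTriangular₂ k A) (OfMap τ) where
  smul l x := (l.1 0 0 • x.1, l.1 1 0 • τ x.1 + l.1 1 1 • x.2)
  one_smul x := by
    refine Prod.ext (one_smul A x.1) ?_
    change (0 : A) • τ x.1 + (1 : A) • x.2 = x.2
    rw [zero_smul, one_smul, zero_add]
  mul_smul l m x := by
    have h01 : ∀ n : lowerTriangular₂ k A, n.1 0 1 = 0 := fun n => n.2
    refine Prod.ext ?_ ?_
    · change (l * m).1 0 0 • x.1 = l.1 0 0 • m.1 0 0 • x.1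
      rw [mul_entry, h01, zero_mul, add_zero, mul_smul]
    · change (l * m).1 1 0 • τ x.1 + (l * m).1 1 1 • x.2 =
        l.1 1 0 • τ (m.1 0 0 • x.1) + l.1 1 1 • (m.1 1 0 • τ x.1 + m.1 1 1 • x.2)
      rw [mul_entry, mul_entry, h01]
      simp only [add_smul, mul_smul, map_smul, smul_add, zero_smul, smul_zero]
      abel
  smul_zero l := by
    refine Prod.ext (smul_zero _) ?_
    change l.1 1 0 • τ 0 + l.1 1 1 • (0 : Q) = 0
    simp
  smul_add l x y := by
    refine Prod.ext (smul_add _ _ _) ?_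
    change l.1 1 0 • τ (x.1 + y.1) + l.1 1 1 • (x.2 + y.2) =
      l.1 1 0 • τ x.1 + l.1 1 1 • x.2 + (l.1 1 0 • τ y.1 + l.1 1 1 • y.2)
    simp only [map_add, smul_add]
    abel
  add_smul l m x := by
    refine Prod.ext (add_smul _ _ _) ?_
    change (l.1 1 0 + m.1 1 0) • τ x.1 + (l.1 1 1 + m.1 1 1) • x.2 =
      l.1 1 0 • τ x.1 + l.1 1 1 • x.2 + (m.1 1 0 • τ x.1 + m.1 1 1 • x.2)
    simp only [add_smul]
    abel
  zero_smul x := by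
    refine Prod.ext (zero_smul _ _) ?_
    change (0 : A) • τ x.1 + (0 : A) • x.2 = 0
    simp

theorem smul_def (l : lowerTriangular₂ k A) (x : OfMap τ) :
    l • x = ((l.1 0 0 • x.1, l.1 1 0 • τ x.1 + l.1 1 1 • x.2) : P × Q) := rfl

instance : IsScalarTower A (lowerTriangular₂ k A) (OfMap τ) where
  smul_assoc a l x := by
    rw [smul_def, smul_def]
    simp only [smul_entry, mul_smul, ← smul_add]
    rfl

variable (k) in
/-- The kernel of `OfMap τ` is the kernel of `τ`. -/
noncomputable def kernEquiv {K : Type u} [AddCommGroup K] [Module A K] (i : K →ₗ[A] P)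
    (hi : Function.Injective i) (hτ : Function.Exact i τ) : K ≃ₗ[A] kern k A (OfMap τ) := by
  have hmem : ∀ x, ((i x, 0) : OfMap τ) ∈ kern k A (OfMap τ) := fun x => by
    refine ⟨Prod.ext (one_smul A (i x)) ?_, Prod.ext (zero_smul A (i x)) ?_⟩
    · change (0 : A) • τ (i x) + (0 : A) • (0 : Q) = 0
      simp
    · change (1 : A) • τ (i x) + (0 : A) • (0 : Q) = 0
      simp [hτ.apply_apply_eq_zero]
  let f : K →ₗ[A] kern k A (OfMap τ) :=
    LinearMap.codRestrict _ (LinearMap.inl A P Q ∘ₗ i) hmem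
  refine .ofBijective f ⟨fun x y h => ?_, fun x => ?_⟩
  · exact hi (congrArg Prod.fst (congrArg Subtype.val h))
  · have h1 : (0 : A) • τ x.1.1 + (0 : A) • x.1.2 = x.1.2 := congrArg Prod.snd x.2.1
    have h2 : (1 : A) • τ x.1.1 + (0 : A) • x.1.2 = 0 := congrArg Prod.snd x.2.2
    rw [zero_smul, zero_smul, zero_add] at h1
    rw [zero_smul, one_smul, add_zero] at h2
    obtain ⟨y, hy⟩ := (hτ _).1 h2
    exact ⟨y, Subtype.ext (Prod.ext hy h1)⟩

end OfMap

end LowerTriangular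

/-- The tensor product `N ⊗_D X` of a right module and a left module over a ring `D`. -/
def BalancedTensor (D N X : Type u) [Ring D] [AddCommGroup N] [AddCommGroup X] [Module Dᵐᵒᵖ N]
    [Module D X] : Type u :=
  TensorProduct ℤ N X ⧸ Submodule.span ℤ
    {z | ∃ (n : N) (d : D) (x : X), z = (MulOpposite.op d • n) ⊗ₜ[ℤ] x - n ⊗ₜ[ℤ] (d • x)}

namespace BalancedTensor

open MulOpposite TensorProduct

variable {D N X Y Z : Type u} [Ring D] [AddCommGroup N] [Module Dᵐᵒᵖ N]
  [AddCommGroup X] [Module D X] [AddCommGroup Y] [Module D Y] [AddCommGroup Z] [Module D Z]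

noncomputable instance : AddCommGroup (BalancedTensor D N X) :=
  inferInstanceAs (AddCommGroup (TensorProduct ℤ N X ⧸ Submodule.span ℤ _))

variable (D) in
/-- The class of a pure tensor in `N ⊗_D X`. -/
def tmul (n : N) (x : X) : BalancedTensor D N X := Submodule.Quotient.mk (n ⊗ₜ x)

theorem tmul_add (n : N) (x y : X) : tmul D n (x + y) = tmul D n x + tmul D n y :=
  congrArg Submodule.Quotient.mk (TensorProduct.tmul_add n x y)

theorem add_tmul (n m : N) (x : X) : tmul D (n + m) x = tmul D n x + tmul D m x :=
  congrArg Submodule.Quotient.mk (TensorProduct.add_tmul n m x)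

theorem op_smul_tmul (n : N) (d : D) (x : X) : tmul D (op d • n) x = tmul D n (d • x) :=
  (Submodule.Quotient.eq _).2 (Submodule.subset_span ⟨n, d, x, rfl⟩)

variable (D X) in
/-- `n ↦ n ⊗ x` as an additive map. -/
noncomputable def tmulLeft (x : X) : N →+ BalancedTensor D N X :=
  .mk' (tmul D · x) fun n m => add_tmul n m x

variable (D N) in
/-- `x ↦ n ⊗ x` as an additive map. -/
noncomputable def tmulRight (n : N) : X →+ BalancedTensor D N X := .mk' (tmul D n) (tmul_add n)

@[simp] theorem tmulLeft_apply (n : N) (x : X) : tmulLeft D X x n = tmul D n x := rfl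

@[simp] theorem tmulRight_apply (n : N) (x : X) : tmulRight D N n x = tmul D n x := rfl

@[simp] theorem zero_tmul (x : X) : tmul D (0 : N) x = 0 := map_zero (tmulLeft D X x)

@[simp] theorem tmul_zero (n : N) : tmul D n (0 : X) = 0 := map_zero (tmulRight D N n)

@[elab_as_elim]
theorem induction_on {p : BalancedTensor D N X → Prop} (t : BalancedTensor D N X) (zero : p 0)
    (tmul : ∀ n x, p (tmul D n x)) (add : ∀ s t, p s → p t → p (s + t)) : p t := by
  obtain ⟨t, rfl⟩ := Submodule.Quotient.mk_surjective _ t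
  induction t with
  | zero => exact zero
  | tmul n x => exact tmul n x
  | add s t hs ht => exact add _ _ hs ht

section Lift

variable {G : Type*} [AddCommGroup G] (f : N → X → G)
  (h₁ : ∀ n m x, f (n + m) x = f n x + f m x) (h₂ : ∀ n x y, f n (x + y) = f n x + f n y)
  (h₃ : ∀ n (d : D) x, f (op d • n) x = f n (d • x))

/-- The additive map out of `N ⊗_D X` defined by a balanced biadditive map. -/
noncomputable def lift : BalancedTensor D N X →+ G :=
  let φ : N →+ X →+ G :=
    .mk' (fun n => .mk' (f n) (h₂ n)) fun n m => AddMonoidHom.ext (h₁ n m)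
  (Submodule.liftQ _ (TensorProduct.liftAddHom φ fun r n x => by
      rw [map_zsmul, map_zsmul]; rfl).toIntLinearMap (by
        rw [Submodule.span_le]
        rintro _ ⟨n, d, x, rfl⟩
        simp [φ, h₃])).toAddMonoidHom

@[simp] theorem lift_tmul (n : N) (x : X) : lift f h₁ h₂ h₃ (tmul D n x) = f n x := rfl

end Lift

section LeftModule

variable {C : Type u} [Ring C] [Module C N] [SMulCommClass C Dᵐᵒᵖ N]

noncomputable instance : Module C (BalancedTensor D N X) where
  smul c := lift (fun n x => tmul D (c • n) x) (fun n m x => by rw [smul_add, add_tmul])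
    (fun n x y => tmul_add _ _ _) (fun n d x => by rw [smul_comm, op_smul_tmul])
  one_smul t := by
    change lift _ _ _ _ t = t
    induction t using induction_on with
    | zero => exact map_zero _
    | tmul n x => rw [lift_tmul, one_smul]
    | add s t hs ht => rw [map_add, hs, ht]
  mul_smul c d t := by
    change lift _ _ _ _ t = lift _ _ _ _ (lift _ _ _ _ t)
    induction t using induction_on with
    | zero => simp only [map_zero]
    | tmul n x => rw [lift_tmul, lift_tmul, lift_tmul, mul_smul]
    | add s t hs ht => simp only [map_add, hs, ht]
  smul_zero c := map_zero (lift _ _ _ _)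
  smul_add c := map_add (lift _ _ _ _)
  add_smul c d t := by
    change lift _ _ _ _ t = lift _ _ _ _ t + lift _ _ _ _ t
    induction t using induction_on with
    | zero => simp only [map_zero, add_zero]
    | tmul n x => rw [lift_tmul, lift_tmul, lift_tmul, add_smul, add_tmul]
    | add s t hs ht => rw [map_add, map_add, map_add, hs, ht]; abel
  zero_smul t := by
    change lift _ _ _ _ t = 0
    induction t using induction_on with
    | zero => exact map_zero _
    | tmul n x => rw [lift_tmul, zero_smul, zero_tmul]
    | add s t hs ht => rw [map_add, hs, ht, add_zero]

theorem smul_tmul (c : C) (n : N) (x : X) : c • tmul D n x = tmul D (c • n) x := rfl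

instance {B : Type u} [Ring B] [Module B N] [SMulCommClass B Dᵐᵒᵖ N] [SMul B C]
    [IsScalarTower B C N] : IsScalarTower B C (BalancedTensor D N X) where
  smul_assoc b c t := by
    induction t using induction_on with
    | zero => simp only [smul_zero]
    | tmul n x => rw [smul_tmul, smul_tmul, smul_tmul, smul_assoc]
    | add s t hs ht => simp only [smul_add, hs, ht]

/-- The linear map out of `N ⊗_D X` defined by a balanced biadditive map. -/
noncomputable def liftₗ {G : Type*} [AddCommGroup G] [Module C G] (f : N → X → G)
    (h₁ : ∀ n m x, f (n + m) x = f n x + f m x) (h₂ : ∀ n x y, f n (x + y) = f n x + f n y)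
    (h₃ : ∀ n (d : D) x, f (op d • n) x = f n (d • x))
    (h₄ : ∀ (c : C) n x, f (c • n) x = c • f n x) : BalancedTensor D N X →ₗ[C] G where
  toFun := lift f h₁ h₂ h₃
  map_add' := map_add _
  map_smul' c t := by
    rw [RingHom.id_apply]
    induction t using induction_on with
    | zero => simp only [smul_zero, map_zero]
    | tmul n x => rw [smul_tmul, lift_tmul, lift_tmul, h₄]
    | add s t hs ht => simp only [smul_add, map_add, hs, ht]

theorem linearMap_ext {G : Type*} [AddCommGroup G] [Module C G]
    {f g : BalancedTensor D N X →ₗ[C] G} (h : ∀ n x, f (tmul D n x) = g (tmul D n x)) : f = g := by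
  refine LinearMap.ext fun t => ?_
  induction t using induction_on with
  | zero => simp only [map_zero]
  | tmul n x => exact h n x
  | add s t hs ht => simp only [map_add, hs, ht]

variable (N C) in
/-- Functoriality of `N ⊗_D X` in `X`. -/
noncomputable def map (f : X →ₗ[D] Y) : BalancedTensor D N X →ₗ[C] BalancedTensor D N Y :=
  liftₗ (fun n x => tmul D n (f x)) (fun _ _ _ => add_tmul _ _ _)
    (fun n x y => by rw [map_add, tmul_add]) (fun n d x => by rw [op_smul_tmul, map_smul])
    fun c n x => rfl

@[simp] theorem map_tmul (f : X →ₗ[D] Y) (n : N) (x : X) :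
    map N C f (tmul D n x) = tmul D n (f x) := rfl

theorem map_id : map N C (LinearMap.id : X →ₗ[D] X) = LinearMap.id :=
  linearMap_ext fun _ _ => rfl

theorem map_comp (g : Y →ₗ[D] Z) (f : X →ₗ[D] Y) :
    map N C (g ∘ₗ f) = map N C g ∘ₗ map N C f :=
  linearMap_ext fun _ _ => rfl

theorem map_sub (f g : X →ₗ[D] Y) : map N C (f - g) = map N C f - map N C g :=
  linearMap_ext fun n x => _root_.map_sub (tmulRight D N n) (f x) (g x)

theorem map_injective [Module.Projective Dᵐᵒᵖ N] {f : X →ₗ[D] Y} (hf : Function.Injective f) :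
    Function.Injective (map N C f) := by
  obtain ⟨s, hs⟩ := (Module.projective_def (R := Dᵐᵒᵖ) (P := N)).1 inferInstance
  have hcoord : ∀ {W : Type u} [AddCommGroup W] [Module D W], ∃ u : BalancedTensor D N W →+ (N →₀ W),
      ∀ n x y, u (tmul D n x) y = unop (s n y) • x := fun {W} _ _ =>
    ⟨lift (fun n x => (s n).mapRange (fun d => unop d • x) (by simp))
      (fun n m x => by ext; simp [add_smul]) (fun n x y => by ext; simp)
      (fun n d x => by ext; simp [mul_smul]), fun n x y => rfl⟩
  obtain ⟨u, hu⟩ := hcoord (W := X)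
  obtain ⟨u', hu'⟩ := hcoord (W := Y)
  let v : (N →₀ X) →+ BalancedTensor D N X := Finsupp.liftAddHom (tmulRight D N)
  have hv : ∀ t, v (u t) = t := fun t => by
    induction t using induction_on with
    | zero => simp only [map_zero]
    | tmul n x =>
      have : u (tmul D n x) = (s n).mapRange (fun d => unop d • x) (by simp) :=
        Finsupp.ext (hu n x)
      rw [this, Finsupp.liftAddHom_apply, Finsupp.sum_mapRange_index (by simp)]
      conv_rhs => rw [← hs n, ← tmulLeft_apply, Finsupp.linearCombination_apply, map_finsuppSum]
      exact Finsupp.sum_congr fun m _ => (op_smul_tmul m _ x).symm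
    | add s t hs ht => simp only [map_add, hs, ht]
  have hnat : ∀ t y, u' (map N C f t) y = f (u t y) := fun t y => by
    induction t using induction_on with
    | zero => simp only [map_zero, Finsupp.zero_apply]
    | tmul n x => rw [map_tmul, hu', hu, map_smul]
    | add s t hs ht => simp only [map_add, Finsupp.add_apply, hs, ht]
  refine (injective_iff_map_eq_zero _).2 fun t ht => ?_
  have : u t = 0 := Finsupp.ext fun y => hf (by rw [← hnat, ht]; simp)
  rw [← hv t, this, map_zero]

theorem projective [Module.Projective C N] [Module.Projective D X] :
    Module.Projective C (BalancedTensor D N X) := by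
  obtain ⟨s, hs⟩ := (Module.projective_def (R := D) (P := X)).1 inferInstance
  have := Module.Projective.finsupp (R := C) (P := N) X
  let u : BalancedTensor D N X →ₗ[C] (X →₀ N) :=
    liftₗ (fun n x => (s x).mapRange (fun d => op d • n) (by simp))
      (fun n m x => by ext; simp) (fun n x y => by ext; simp [add_smul])
      (fun n d x => by ext; simp [mul_smul])
      (fun c n x => by ext; simp [smul_comm])
  let v : (X →₀ N) →ₗ[C] BalancedTensor D N X :=
    Finsupp.lsum ℕ fun x => { tmulLeft D X x with map_smul' := fun c n => rfl }
  refine .of_split u v (linearMap_ext fun n x => ?_)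
  change v ((s x).mapRange (fun d => op d • n) (by simp)) = tmul D n x
  rw [Finsupp.lsum_apply, Finsupp.sum_mapRange_index (by simp)]
  conv_rhs => rw [← hs x, ← tmulRight_apply, Finsupp.linearCombination_apply, map_finsuppSum]
  exact Finsupp.sum_congr fun y _ => op_smul_tmul n _ y

theorem exists_comp_map_eq {f : X →ₗ[D] Y} {g : Y →ₗ[D] Z} (hfg : Function.Exact f g)
    (hg : Function.Surjective g) {G : Type*} [AddCommGroup G] [Module C G]
    (w : BalancedTensor D N Y →ₗ[C] G) (hw : ∀ t, w (map N C f t) = 0) :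
    ∃ v : BalancedTensor D N Z →ₗ[C] G, v ∘ₗ map N C g = w := by
  have hker : ∀ n y y', g y = g y' → w (tmul D n y) = w (tmul D n y') := fun n y y' h => by
    obtain ⟨x, hx⟩ := (hfg (y - y')).1 (by rw [_root_.map_sub, h, sub_self])
    have := hw (tmul D n x)
    rwa [map_tmul, hx, ← tmulRight_apply, _root_.map_sub, _root_.map_sub, sub_eq_zero] at this
  obtain ⟨h, hh⟩ := hg.hasRightInverse
  refine ⟨liftₗ (fun n z => w (tmul D n (h z))) (fun n m z => ?_) (fun n z z' => ?_)
    (fun n d z => ?_) (fun c n z => ?_), linearMap_ext fun n y => hker n _ _ (hh _)⟩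
  · rw [add_tmul, map_add]
  · rw [← map_add, ← tmul_add]
    exact hker _ _ _ (by rw [hh, map_add, hh, hh])
  · rw [op_smul_tmul]
    exact hker _ _ _ (by rw [map_smul, hh, hh])
  · rw [← map_smul, smul_tmul]

end LeftModule

end BalancedTensor

namespace BalancedTensor

open MulOpposite TensorProduct

section ProjectiveBimodule

theorem projective_of_projective_bimodule (k : Type u) [Field k] {C P X : Type u} [Ring C]
    [Algebra k C] [AddCommGroup P] [Module (C ⊗[k] Cᵐᵒᵖ) P] [Module C P] [Module Cᵐᵒᵖ P]
    [SMulCommClass C Cᵐᵒᵖ P] [AddCommGroup X] [Module C X]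
    [Module.Projective (C ⊗[k] Cᵐᵒᵖ) P]
    (hleft : ∀ (c : C) (p : P), c • p = (c ⊗ₜ[k] (1 : Cᵐᵒᵖ)) • p)
    (hright : ∀ (c : Cᵐᵒᵖ) (p : P), c • p = ((1 : C) ⊗ₜ[k] c) • p) :
    Module.Projective C (BalancedTensor C P X) := by
  let : Module k X := Module.compHom X (algebraMap k C)
  have : IsScalarTower k C X := ⟨fun c a x => by rw [Algebra.smul_def, mul_smul]; rfl⟩
  let : Module k (BalancedTensor C P X) := Module.compHom _ (algebraMap k C)
  have : IsScalarTower k C (BalancedTensor C P X) :=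
    ⟨fun c a x => by rw [Algebra.smul_def, mul_smul]; rfl⟩
  obtain ⟨s, hs⟩ := (Module.projective_def (R := C ⊗[k] Cᵐᵒᵖ) (P := P)).1 inferInstance
  let E : X → C ⊗[k] Cᵐᵒᵖ →ₗ[C] C ⊗[k] X := fun x => LinearMap.baseChange C
    { toFun := fun b => unop b • x
      map_add' := fun b c => by rw [unop_add, add_smul]
      map_smul' := fun r b => by rw [unop_smul, smul_assoc]; rfl }
  have hE : ∀ x a b, E x (a ⊗ₜ b) = a ⊗ₜ (unop b • x) := fun x a b => rfl
  have hEadd : ∀ x y z, E (x + y) z = E x z + E y z := fun x y z => by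
    induction z with
    | zero => simp only [map_zero, add_zero]
    | tmul a b => simp only [hE, smul_add, TensorProduct.tmul_add]
    | add z w hz hw => simp only [map_add, hz, hw]; abel
  have hEright : ∀ x (c : C) z, E x ((1 ⊗ₜ op c) * z) = E (c • x) z := fun x c z => by
    induction z with
    | zero => simp only [mul_zero, map_zero]
    | tmul a b => simp [hE, mul_smul]
    | add z w hz hw => simp only [mul_add, map_add, hz, hw]
  have hEleft : ∀ x (c : C) z, E x ((c ⊗ₜ 1) * z) = c • E x z := fun x c z => by
    rw [← map_smul]
    congr 1
    induction z with
    | zero => simp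
    | tmul a b => simp [TensorProduct.smul_tmul']
    | add z w hz hw => rw [mul_add, smul_add, hz, hw]
  let u : BalancedTensor C P X →ₗ[C] (P →₀ C ⊗[k] X) :=
    liftₗ (fun p x => (s p).mapRange (E x) (map_zero _)) (fun p q x => by ext1; simp)
      (fun p x y => by ext1; simp [hEadd])
      (fun p c x => by ext1; simp [hright, hEright])
      (fun c p x => by ext1; simp [hleft, hEleft])
  let l : P → X →ₗ[k] BalancedTensor C P X := fun q =>
    { tmulRight C P q with
      map_smul' := fun r x => by
        change tmul C q (algebraMap k C r • x) = algebraMap k C r • tmul C q x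
        rw [← op_smul_tmul, smul_tmul, hright, hleft]
        have : (1 : C) ⊗ₜ[k] op (algebraMap k C r) = algebraMap k C r ⊗ₜ[k] (1 : Cᵐᵒᵖ) := by
          rw [Algebra.algebraMap_eq_smul_one, ← TensorProduct.smul_tmul', op_smul, op_one,
            TensorProduct.tmul_smul]
        rw [this] }
  let L : P → C ⊗[k] X →ₗ[C] BalancedTensor C P X := fun q =>
    AlgebraTensorModule.lift (LinearMap.toSpanSingleton C _ (l q))
  let v : (P →₀ C ⊗[k] X) →ₗ[C] BalancedTensor C P X :=
    Finsupp.lsum ℕ L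
  have hv : ∀ q x z, L q (E x z) = tmul C (z • q) x := fun q x z => by
    induction z with
    | zero =>
      rw [map_zero, map_zero]
      exact (zero_tmul x).symm.trans (congrArg (tmul C · x) (zero_smul (C ⊗[k] Cᵐᵒᵖ) q).symm)
    | tmul a b =>
      rw [hE]
      change a • tmul C q (unop b • x) = _
      rw [← op_smul_tmul, smul_tmul, hleft, op_unop, hright, smul_smul,
        Algebra.TensorProduct.tmul_mul_tmul, mul_one, one_mul]
    | add z w hz hw => rw [map_add, map_add, hz, hw, add_smul, add_tmul]
  have := Module.Projective.finsupp (R := C) (P := C ⊗[k] X) P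
  refine .of_split u v (linearMap_ext fun p x => ?_)
  change v ((s p).mapRange (E x) (map_zero _)) = tmul C p x
  rw [Finsupp.lsum_apply, Finsupp.sum_mapRange_index (fun q => map_zero _)]
  conv_rhs => rw [← hs p, ← tmulLeft_apply, Finsupp.linearCombination_apply, map_finsuppSum]
  exact Finsupp.sum_congr fun q _ => hv q x _

end ProjectiveBimodule

section StableInverse

variable {C D M N P X Y : Type u} [Ring C] [Ring D] [AddCommGroup M] [AddCommGroup N]
  [AddCommGroup P] [Module C M] [Module Dᵐᵒᵖ M] [SMulCommClass C Dᵐᵒᵖ M] [Module D N]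
  [Module Cᵐᵒᵖ N] [SMulCommClass D Cᵐᵒᵖ N] [Module C P] [Module Cᵐᵒᵖ P]
  [AddCommGroup X] [Module C X] [AddCommGroup Y] [Module C Y]

theorem linearMap_ext₂ {G : Type*} [AddCommGroup G] [Module C G]
    {f g : BalancedTensor D M (BalancedTensor C N X) →ₗ[C] G}
    (h : ∀ m n x, f (tmul D m (tmul C n x)) = g (tmul D m (tmul C n x))) : f = g := by
  refine linearMap_ext fun m t => ?_
  induction t using induction_on with
  | zero => simp only [tmul_zero, map_zero]
  | tmul n x => exact h m n x
  | add s t hs ht => simp only [tmul_add, map_add, hs, ht]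

variable (θ : BalancedTensor D M N ≃ₗ[C] C × P)
  (hθ : ∀ (c : C) (m : M) (n : N), θ (tmul D m (op c • n)) =
    ((θ (tmul D m n)).1 * c, op c • (θ (tmul D m n)).2))

include hθ

variable (X) in
/-- The map `M ⊗_D (N ⊗_C X) → X` induced by the projection `M ⊗_D N → C`. -/
noncomputable def projection : BalancedTensor D M (BalancedTensor C N X) →ₗ[C] X :=
  liftₗ (fun m => lift (fun n x => (θ (tmul D m n)).1 • x)
      (fun n n' x => by rw [tmul_add, map_add, Prod.fst_add, add_smul])
      (fun n x y => smul_add _ _ _) (fun n c x => by rw [hθ, mul_smul]))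
    (fun m m' t => by
      induction t using induction_on with
      | zero => simp only [map_zero, add_zero]
      | tmul n x => simp only [lift_tmul, add_tmul, map_add, Prod.fst_add, add_smul]
      | add s t hs ht => simp only [map_add] at hs ht ⊢; rw [hs, ht]; abel)
    (fun m s t => map_add _ _ _)
    (fun m d t => by
      induction t using induction_on with
      | zero => simp only [smul_zero, map_zero]
      | tmul n x => rw [smul_tmul, lift_tmul, lift_tmul, op_smul_tmul]
      | add s t hs ht => rw [smul_add, map_add, map_add, hs, ht])
    (fun c m t => by
      induction t using induction_on with
      | zero => simp only [smul_zero, map_zero]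
      | tmul n x => rw [lift_tmul, lift_tmul, ← smul_tmul, map_smul, Prod.smul_fst, smul_assoc]
      | add s t hs ht => rw [map_add, map_add, hs, ht, smul_add])

theorem projection_naturality (f : X →ₗ[C] Y) :
    projection Y θ hθ ∘ₗ map M C (map N D f) = f ∘ₗ projection X θ hθ :=
  linearMap_ext₂ fun m n x => (map_smul f (θ (tmul D m n)).1 x).symm

theorem exists_splitting_projection [SMulCommClass C Cᵐᵒᵖ P] :
    ∃ (i : X →ₗ[C] BalancedTensor D M (BalancedTensor C N X))
      (r : BalancedTensor D M (BalancedTensor C N X) →ₗ[C] BalancedTensor C P X)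
      (j : BalancedTensor C P X →ₗ[C] BalancedTensor D M (BalancedTensor C N X)),
      (∀ x, projection X θ hθ (i x) = x) ∧ ∀ t, i (projection X θ hθ t) + j (r t) = t := by
  let c : X → BalancedTensor D M N →ₗ[C] BalancedTensor D M (BalancedTensor C N X) := fun x =>
    map M C { tmulLeft C X x with map_smul' := fun d n => rfl }
  have hc : ∀ x m n, c x (tmul D m n) = tmul D m (tmul C n x) := fun x m n => rfl
  have hcadd : ∀ x y, c (x + y) = c x + c y := fun x y => linearMap_ext fun m n => by
    simp only [hc, LinearMap.add_apply, tmul_add]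
  have hcsmul : ∀ (a : C) x t, c (a • x) t = c x (θ.symm ((θ t).1 * a, op a • (θ t).2)) :=
    fun a x t => by
      induction t using induction_on with
      | zero =>
        rw [map_zero, map_zero, Prod.fst_zero, Prod.snd_zero, zero_mul, smul_zero,
          Prod.mk_zero_zero, map_zero, map_zero]
      | tmul m n => rw [hc, ← op_smul_tmul, ← hθ, θ.symm_apply_apply, hc]
      | add s t hs ht =>
        rw [map_add, hs, ht, ← map_add, ← map_add, Prod.mk_add_mk, ← add_mul, ← smul_add,
          ← Prod.fst_add, ← Prod.snd_add, ← map_add]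
  have hcsymm : ∀ (a : C) x b p, c (a • x) (θ.symm (b, p)) = c x (θ.symm (b * a, op a • p)) :=
    fun a x b p => by rw [hcsmul, θ.apply_symm_apply]
  have hproj : ∀ x t, projection X θ hθ (c x t) = (θ t).1 • x := fun x t => by
    induction t using induction_on with
    | zero => simp
    | tmul m n => rfl
    | add s t hs ht => rw [map_add, map_add, hs, ht, map_add, Prod.fst_add, add_smul]
  let i : X →ₗ[C] BalancedTensor D M (BalancedTensor C N X) :=
    { toFun := fun x => c x (θ.symm (1, 0))
      map_add' := fun x y => by rw [hcadd, LinearMap.add_apply]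
      map_smul' := fun a x => by
        rw [hcsymm, RingHom.id_apply, ← map_smul, ← map_smul, Prod.smul_mk]
        simp }
  let j : BalancedTensor C P X →ₗ[C] BalancedTensor D M (BalancedTensor C N X) :=
    liftₗ (fun p x => c x (θ.symm (0, p)))
      (fun p q x => by rw [← map_add, ← map_add, Prod.mk_add_mk, add_zero])
      (fun p x y => by rw [hcadd, LinearMap.add_apply])
      (fun p a x => by rw [hcsymm, zero_mul])
      (fun a p x => by rw [← map_smul, ← map_smul, Prod.smul_mk, smul_zero])
  let r : BalancedTensor D M (BalancedTensor C N X) →ₗ[C] BalancedTensor C P X :=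
    liftₗ (fun m => lift (fun n x => tmul C (θ (tmul D m n)).2 x)
        (fun n n' x => by rw [tmul_add, map_add, Prod.snd_add, add_tmul])
        (fun n x y => tmul_add _ _ _) (fun n c x => by rw [hθ, op_smul_tmul]))
      (fun m m' t => by
        induction t using induction_on with
        | zero => simp only [map_zero, add_zero]
        | tmul n x => simp only [lift_tmul, add_tmul, map_add, Prod.snd_add]
        | add s t hs ht => simp only [map_add] at hs ht ⊢; rw [hs, ht]; abel)
      (fun m s t => map_add _ _ _)
      (fun m d t => by
        induction t using induction_on with
        | zero => simp only [smul_zero, map_zero]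
        | tmul n x => rw [smul_tmul, lift_tmul, lift_tmul, op_smul_tmul]
        | add s t hs ht => rw [smul_add, map_add, map_add, hs, ht])
      (fun c m t => by
        induction t using induction_on with
        | zero => simp only [smul_zero, map_zero]
        | tmul n x => rw [lift_tmul, lift_tmul, ← smul_tmul, map_smul, Prod.smul_snd, smul_tmul]
        | add s t hs ht => rw [map_add, map_add, hs, ht, smul_add])
  refine ⟨i, r, j, fun x => ?_, fun t => ?_⟩
  · change projection X θ hθ (c x _) = x
    rw [hproj, θ.apply_symm_apply, one_smul]
  · refine LinearMap.congr_fun (f := i ∘ₗ projection X θ hθ + j ∘ₗ r) (g := LinearMap.id)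
      (linearMap_ext₂ fun m n x => ?_) t
    change c ((θ (tmul D m n)).1 • x) (θ.symm (1, 0)) + c x (θ.symm (0, (θ (tmul D m n)).2)) = _
    rw [hcsymm, ← map_add, ← map_add, Prod.mk_add_mk, one_mul, smul_zero, add_zero, zero_add,
      θ.symm_apply_apply, hc, LinearMap.id_apply]

end StableInverse

end BalancedTensor

theorem Module.exists_exact_projective (R : Type u) [Ring R] (X : Type u) [AddCommGroup X]
    [Module R X] : ∃ (Y Z : Type u) (_ : AddCommGroup Y) (_ : Module R Y) (_ : AddCommGroup Z)
      (_ : Module R Z) (_ : Module.Projective R Y) (f : Z →ₗ[R] Y) (p : Y →ₗ[R] X),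
      Function.Injective f ∧ Function.Exact f p ∧ Function.Surjective p :=
  let p : (X →₀ R) →ₗ[R] X := Finsupp.linearCombination R id
  ⟨X →₀ R, LinearMap.ker p, inferInstance, inferInstance, inferInstance, inferInstance,
    inferInstance, (LinearMap.ker p).subtype, p, Subtype.val_injective,
    fun x => ⟨fun hx => ⟨⟨x, hx⟩, rfl⟩, fun ⟨y, hy⟩ => hy ▸ y.2⟩,
    Finsupp.linearCombination_id_surjective R X⟩

namespace LowerTriangular

variable {k A X : Type u} [Field k] [Ring A] [Algebra k A] [AddCommGroup X]
  [Module (lowerTriangular₂ k A) X]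

variable (k A X) in
/-- Restriction of scalars along the diagonal embedding. -/
abbrev restrictDiag : Module A X := Module.compHom X (diag k)

theorem isScalarTower_restrictDiag :
    letI := restrictDiag k A X
    IsScalarTower A (lowerTriangular₂ k A) X :=
  letI := restrictDiag k A X
  ⟨fun a l x => mul_smul (diag k a) l x⟩

end LowerTriangular

namespace BalancedTensor

open MulOpposite LowerTriangular

variable {k : Type u} [Field k] {A B : Type u} [Ring A] [Algebra k A] [Ring B] [Algebra k B]
  [FiniteDimensional k A] [FiniteDimensional k B] [Module.Injective A A] [Module.Injective B B]
  {N X Y Z : Type u} [AddCommGroup N]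
  [Module (lowerTriangular₂ k B) N] [Module (lowerTriangular₂ k A)ᵐᵒᵖ N]
  [SMulCommClass (lowerTriangular₂ k B) (lowerTriangular₂ k A)ᵐᵒᵖ N]
  [Module B N] [SMulCommClass B (lowerTriangular₂ k A)ᵐᵒᵖ N]
  [IsScalarTower B (lowerTriangular₂ k B) N]
  [AddCommGroup X] [Module A X] [Module (lowerTriangular₂ k A) X]
  [IsScalarTower A (lowerTriangular₂ k A) X] [Module.Projective A X]
  [AddCommGroup Z] [Module A Z] [Module (lowerTriangular₂ k A) Z]
  [IsScalarTower A (lowerTriangular₂ k A) Z]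
  [AddCommGroup Y] [Module A Y] [Module (lowerTriangular₂ k A) Y]
  [IsScalarTower A (lowerTriangular₂ k A) Y] [Module.Projective A Y]

theorem projective_of_exact [Module.Projective (lowerTriangular₂ k B) N]
    [Module.Projective (lowerTriangular₂ k A)ᵐᵒᵖ N] [Module.Projective (lowerTriangular₂ k A) Y]
    (f : Z →ₗ[lowerTriangular₂ k A] Y) (p : Y →ₗ[lowerTriangular₂ k A] X)
    (hf : Function.Injective f) (hfp : Function.Exact f p) (hp : Function.Surjective p) :
    Module.Projective B (BalancedTensor (lowerTriangular₂ k A) N X) := by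
  obtain ⟨j, hj⟩ := Module.projective_lifting_property (p.restrictScalars A)
    (LinearMap.id : X →ₗ[A] X) hp
  replace hj : ∀ x, p (j x) = x := LinearMap.congr_fun hj
  have : Module.Projective A Z := by
    choose s hs using fun y => (hfp (y - j (p y))).1 (by rw [_root_.map_sub, hj, sub_self])
    have hjp : ∀ (a : A) y, j (p (a • y)) = a • j (p y) :=
      (j ∘ₗ p.restrictScalars A).map_smul
    let s' : Y →ₗ[A] Z :=
      { toFun := s
        map_add' := fun x y => hf <| by
          rw [map_add, hs, hs, hs, map_add, map_add]; abel
        map_smul' := fun a x => hf <| by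
          rw [hs, hjp]
          exact (smul_sub a x _).symm.trans
            ((congrArg (a • ·) (hs x)).symm.trans ((f.restrictScalars A).map_smul a (s x)).symm) }
    refine .of_split (f.restrictScalars A) s' (LinearMap.ext fun z => hf ?_)
    change f (s (f z)) = f z
    rw [hs, hfp.apply_apply_eq_zero, map_zero, sub_zero]
  have := Module.Injective.of_projective (A := A) k Z
  have : Module.Projective (lowerTriangular₂ k A) Z :=
    projective_of_kern_eq_bot (X := Z) fun x hx =>
      hf ((eq_zero_of_mem_kern_projective (map_mem_kern f hx)).trans f.map_zero.symm)
  have := projective (D := lowerTriangular₂ k A) (C := lowerTriangular₂ k B) (N := N)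
    (X := Z)
  have := projective (D := lowerTriangular₂ k A) (C := lowerTriangular₂ k B) (N := N)
    (X := Y)
  have := projective_of_projective k (A := B)
    (X := BalancedTensor (lowerTriangular₂ k A) N Z)
  have := projective_of_projective k (A := B)
    (X := BalancedTensor (lowerTriangular₂ k A) N Y)
  have := Module.Injective.of_projective (A := B) k
    (BalancedTensor (lowerTriangular₂ k A) N Z)
  have hf' : Function.Injective (map N B f) := map_injective hf
  obtain ⟨r, hr⟩ := Module.Injective.exists_extension_of_ker_le (map N B f) LinearMap.id
    fun x hx => hf' (hx.trans (map N B f).map_zero.symm)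
  obtain ⟨v, hv⟩ := exists_comp_map_eq (C := B) (N := N) hfp hp
    (LinearMap.id - map N B f ∘ₗ r) fun t => by
      rw [LinearMap.sub_apply, LinearMap.comp_apply, hr]; exact sub_self _
  refine .of_split v (map N B p) (linearMap_ext fun n x => ?_)
  obtain ⟨y, rfl⟩ := hp x
  have hpf : ∀ t, map N B p (map N B f t) = 0 := fun t => by
    rw [← LinearMap.comp_apply, ← map_comp, hfp.linearMap_comp_eq_zero]
    induction t using induction_on with
    | zero => rw [map_zero]
    | tmul n x => rw [map_tmul, LinearMap.zero_apply, tmul_zero]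
    | add s t hs ht => rw [map_add, hs, ht, add_zero]
  have hvy := LinearMap.congr_fun hv (tmul _ n y)
  rw [LinearMap.comp_apply, map_tmul] at hvy
  rw [LinearMap.comp_apply, hvy, LinearMap.sub_apply, _root_.map_sub, LinearMap.comp_apply, hpf,
    sub_zero, LinearMap.id_apply, LinearMap.id_apply, map_tmul]

variable (X N) in
theorem projective_of_diag_projective [Module.Projective (lowerTriangular₂ k B) N]
    [Module.Projective (lowerTriangular₂ k A)ᵐᵒᵖ N] :
    Module.Projective B (BalancedTensor (lowerTriangular₂ k A) N X) := by
  obtain ⟨Y, Z, _, _, _, _, _, f, p, hf, hfp, hp⟩ :=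
    Module.exists_exact_projective (lowerTriangular₂ k A) X
  let := restrictDiag k A Y
  let := restrictDiag k A Z
  have := isScalarTower_restrictDiag (k := k) (A := A) (X := Y)
  have := isScalarTower_restrictDiag (k := k) (A := A) (X := Z)
  have := projective_of_projective k (A := A) (X := Y)
  exact projective_of_exact f p hf hfp hp

end BalancedTensor

namespace BalancedTensor

open MulOpposite LowerTriangular TensorProduct

section

variable {k : Type u} [Field k] {A B : Type u} [Ring A] [Algebra k A] [Ring B] [Algebra k B]
  [FiniteDimensional k A] [Module.Injective A A]
  {N X Y : Type u} [AddCommGroup N]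
  [Module (lowerTriangular₂ k B) N] [Module (lowerTriangular₂ k A)ᵐᵒᵖ N]
  [SMulCommClass (lowerTriangular₂ k B) (lowerTriangular₂ k A)ᵐᵒᵖ N]
  [Module B N] [SMulCommClass B (lowerTriangular₂ k A)ᵐᵒᵖ N]
  [IsScalarTower B (lowerTriangular₂ k B) N] [Module.Projective (lowerTriangular₂ k B) N]
  [AddCommGroup X] [Module A X] [Module (lowerTriangular₂ k A) X]
  [IsScalarTower A (lowerTriangular₂ k A) X]
  [AddCommGroup Y] [Module A Y] [Module (lowerTriangular₂ k A) Y]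
  [IsScalarTower A (lowerTriangular₂ k A) Y] [Module.Projective A Y]

theorem map_apply_eq_zero_of_mem_kern (f : X →ₗ[lowerTriangular₂ k A] Y)
    (hf : ∀ x ∈ kern k A X, f x = 0) {t : BalancedTensor (lowerTriangular₂ k A) N X}
    (ht : t ∈ kern k B (BalancedTensor (lowerTriangular₂ k A) N X)) :
    map N (lowerTriangular₂ k B) f t = 0 := by
  obtain ⟨Q, Z, _, _, _, _, _, -, p, -, -, hp⟩ :=
    Module.exists_exact_projective (lowerTriangular₂ k A) Y
  let := restrictDiag k A Q
  have := isScalarTower_restrictDiag (k := k) (A := A) (X := Q)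
  obtain ⟨j, hj⟩ := Module.projective_lifting_property (p.restrictScalars A)
    (LinearMap.id : Y →ₗ[A] Y) hp
  have := Module.Injective.of_projective (A := A) k Y
  obtain ⟨g, hg⟩ := exists_lift_of_forall_mem_kern f hf p j (LinearMap.congr_fun hj)
  obtain rfl : p ∘ₗ g = f := LinearMap.ext hg
  have := projective (D := lowerTriangular₂ k A) (C := lowerTriangular₂ k B) (N := N) (X := Q)
  rw [map_comp, LinearMap.comp_apply,
    eq_zero_of_mem_kern_projective (map_mem_kern (map N (lowerTriangular₂ k B) g) ht), map_zero]

theorem kernMap_map_eq {f g : X →ₗ[lowerTriangular₂ k A] Y} (h : kernMap f = kernMap g) :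
    kernMap (A := B) (map N (lowerTriangular₂ k B) f) =
      kernMap (A := B) (map N (lowerTriangular₂ k B) g) := by
  refine LinearMap.ext fun t => Subtype.ext (sub_eq_zero.1 ?_)
  rw [coe_kernMap, coe_kernMap, ← LinearMap.sub_apply, ← map_sub]
  refine map_apply_eq_zero_of_mem_kern (f - g) (fun x hx => ?_) t.2
  exact sub_eq_zero.2 (congrArg Subtype.val (LinearMap.congr_fun h ⟨x, hx⟩))

end

section

variable {k : Type u} [Field k] {A D : Type u} [Ring A] [Algebra k A] [Ring D]
  {M N P X Y : Type u} [AddCommGroup M] [AddCommGroup N] [AddCommGroup P]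
  [Module (lowerTriangular₂ k A) M] [Module Dᵐᵒᵖ M]
  [SMulCommClass (lowerTriangular₂ k A) Dᵐᵒᵖ M] [Module D N]
  [Module (lowerTriangular₂ k A)ᵐᵒᵖ N] [SMulCommClass D (lowerTriangular₂ k A)ᵐᵒᵖ N]
  [Module A M] [SMulCommClass A Dᵐᵒᵖ M] [IsScalarTower A (lowerTriangular₂ k A) M]
  [Module (lowerTriangular₂ k A) P] [Module (lowerTriangular₂ k A)ᵐᵒᵖ P]
  [SMulCommClass (lowerTriangular₂ k A) (lowerTriangular₂ k A)ᵐᵒᵖ P]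
  [AddCommGroup X] [Module A X] [Module (lowerTriangular₂ k A) X]
  [IsScalarTower A (lowerTriangular₂ k A) X]
  [AddCommGroup Y] [Module A Y] [Module (lowerTriangular₂ k A) Y]
  [IsScalarTower A (lowerTriangular₂ k A) Y]
  (θ : BalancedTensor D M N ≃ₗ[lowerTriangular₂ k A] lowerTriangular₂ k A × P)
  (hθ : ∀ (c : lowerTriangular₂ k A) (m : M) (n : N), θ (tmul D m (op c • n)) =
    ((θ (tmul D m n)).1 * c, op c • (θ (tmul D m n)).2))
  (hP : ∀ (X : Type u) [AddCommGroup X] [Module (lowerTriangular₂ k A) X],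
    Module.Projective (lowerTriangular₂ k A) (BalancedTensor (lowerTriangular₂ k A) P X))

include hP

theorem bijective_kernMap_projection :
    Function.Bijective (kernMap (k := k) (A := A) (projection X θ hθ)) := by
  obtain ⟨i, r, j, hi, hij⟩ := exists_splitting_projection (X := X) θ hθ
  have := hP X
  let := restrictDiag k A (BalancedTensor (lowerTriangular₂ k A) P X)
  have := isScalarTower_restrictDiag (k := k) (A := A)
    (X := BalancedTensor (lowerTriangular₂ k A) P X)
  have hker : ∀ t ∈ kern k A (BalancedTensor D M (BalancedTensor (lowerTriangular₂ k A) N X)),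
      i (projection X θ hθ t) = t := fun t ht => by
    conv_rhs => rw [← hij t, eq_zero_of_mem_kern_projective (map_mem_kern r ht), map_zero,
      add_zero]
  refine ⟨fun s t h => Subtype.ext ?_, fun x => ⟨⟨i x, map_mem_kern i x.2⟩, Subtype.ext (hi _)⟩⟩
  rw [← hker s s.2, ← hker t t.2]
  exact congrArg i (congrArg Subtype.val h)

/-- The projection `M ⊗_D (N ⊗_C X) → X` induces an isomorphism on kernels. -/
noncomputable def kernEquivProjection :
    kern k A (BalancedTensor D M (BalancedTensor (lowerTriangular₂ k A) N X)) ≃ₗ[A] kern k A X :=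
  .ofBijective (kernMap (projection X θ hθ)) (bijective_kernMap_projection θ hθ hP)

end

end BalancedTensor

namespace CategoryTheory

/-- Functors which are mutually inverse modulo full and essentially surjective functors
`K` and `K'` induce an equivalence of the targets of `K` and `K'`. -/
theorem Functor.nonempty_equivalence_of_full_of_essSurj {C C' D D' : Type*} [Category* C]
    [Category* C'] [Category* D] [Category* D'] (K : C ⥤ D) (K' : C' ⥤ D') [K.Full] [K.EssSurj]
    [K'.Full] [K'.EssSurj] (F : C ⥤ C') (G : C' ⥤ C)
    (hF : ∀ {X Y : C} (f g : X ⟶ Y), K.map f = K.map g → K'.map (F.map f) = K'.map (F.map g))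
    (hG : ∀ {X Y : C'} (f g : X ⟶ Y), K'.map f = K'.map g → K.map (G.map f) = K.map (G.map g))
    (e : F ⋙ G ⋙ K ≅ K) (e' : G ⋙ F ⋙ K' ≅ K') : Nonempty (D ≌ D') := by
  let E : Quotient K.homRel ⥤ D := Quotient.lift _ K fun _ _ _ _ h => h
  let E' : Quotient K'.homRel ⥤ D' := Quotient.lift _ K' fun _ _ _ _ h => h
  have : E.IsEquivalence := inferInstance
  have : E'.IsEquivalence := inferInstance
  let F' : Quotient K.homRel ⥤ Quotient K'.homRel :=
    Quotient.lift _ (F ⋙ Quotient.functor _) fun _ _ f g h => Quotient.sound _ (hF f g h)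
  let G' : Quotient K'.homRel ⥤ Quotient K.homRel :=
    Quotient.lift _ (G ⋙ Quotient.functor _) fun _ _ f g h => Quotient.sound _ (hG f g h)
  let η : F' ⋙ G' ≅ 𝟭 _ := Functor.fullyFaithfulCancelRight E (Quotient.natIsoLift _ e)
  let ε : G' ⋙ F' ≅ 𝟭 _ := Functor.fullyFaithfulCancelRight E' (Quotient.natIsoLift _ e')
  exact ⟨E.asEquivalence.symm.trans ((Equivalence.mk F' G' η.symm ε).trans E'.asEquivalence)⟩

end CategoryTheory

namespace LowerTriangular

open CategoryTheory

/-- Modules over lower triangular matrices which are projective along the diagonal embedding. -/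
structure DiagProjective (k A : Type u) [Field k] [Ring A] [Algebra k A] where
  carrier : Type u
  [addCommGroup : AddCommGroup carrier]
  [module : Module A carrier]
  [moduleTriangular : Module (lowerTriangular₂ k A) carrier]
  [isScalarTower : IsScalarTower A (lowerTriangular₂ k A) carrier]
  [projective : Module.Projective A carrier]

namespace DiagProjective

attribute [instance] addCommGroup module moduleTriangular isScalarTower projective

variable (k A B : Type u) [Field k] [Ring A] [Algebra k A] [Ring B] [Algebra k B]

instance : Category (DiagProjective k A) where
  Hom X Y := X.carrier →ₗ[lowerTriangular₂ k A] Y.carrier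
  id _ := LinearMap.id
  comp f g := g ∘ₗ f

/-- The functor taking kernels. -/
def kernFunctor : DiagProjective k A ⥤ ModuleCat.{u} A where
  obj X := ModuleCat.of A (kern k A X.carrier)
  map f := ModuleCat.ofHom (kernMap f)

variable [FiniteDimensional k A] [Module.Injective A A]

instance : (kernFunctor k A).Full where
  map_surjective {X Y} φ := by
    have := Module.Injective.of_projective (A := A) k Y.carrier
    obtain ⟨f, hf⟩ := exists_kernMap_eq φ.hom
    exact ⟨f, ModuleCat.hom_ext hf⟩

instance : (kernFunctor k A).EssSurj where
  mem_essImage K := by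
    obtain ⟨P, _, _, _, i, hi⟩ := Module.exists_injective_linearMap_projective (A := A) k K
    obtain ⟨Q, _, _, _, j, hj⟩ := Module.exists_injective_linearMap_projective (A := A) k
      (P ⧸ LinearMap.range i)
    have hex : Function.Exact i (j ∘ₗ (LinearMap.range i).mkQ) := fun x => by
      rw [LinearMap.comp_apply, map_eq_zero_iff j hj, Submodule.mkQ_apply,
        Submodule.Quotient.mk_eq_zero]
      rfl
    exact ⟨⟨OfMap (j ∘ₗ (LinearMap.range i).mkQ)⟩, ⟨(OfMap.kernEquiv k _ i hi hex).symm.toModuleIso⟩⟩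

variable {k A B} [FiniteDimensional k B] [Module.Injective B B]
  (N : Type u) [AddCommGroup N] [Module (lowerTriangular₂ k B) N]
  [Module (lowerTriangular₂ k A)ᵐᵒᵖ N]
  [SMulCommClass (lowerTriangular₂ k B) (lowerTriangular₂ k A)ᵐᵒᵖ N]
  [Module B N] [SMulCommClass B (lowerTriangular₂ k A)ᵐᵒᵖ N]
  [IsScalarTower B (lowerTriangular₂ k B) N] [Module.Projective (lowerTriangular₂ k B) N]
  [Module.Projective (lowerTriangular₂ k A)ᵐᵒᵖ N]

/-- Tensoring with a bimodule which is projective on both sides. -/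
noncomputable def tensorFunctor : DiagProjective k A ⥤ DiagProjective k B where
  obj X :=
    { carrier := BalancedTensor (lowerTriangular₂ k A) N X.carrier
      projective := BalancedTensor.projective_of_diag_projective N X.carrier }
  map f := BalancedTensor.map N (lowerTriangular₂ k B) f
  map_id _ := BalancedTensor.map_id
  map_comp f g := BalancedTensor.map_comp g f

theorem kernFunctor_map_tensorFunctor_map {X Y : DiagProjective k A} (f g : X ⟶ Y)
    (h : (kernFunctor k A).map f = (kernFunctor k A).map g) :
    (kernFunctor k B).map ((tensorFunctor N).map f) =
      (kernFunctor k B).map ((tensorFunctor N).map g) :=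
  ModuleCat.hom_ext (BalancedTensor.kernMap_map_eq (congrArg ModuleCat.Hom.hom h))

open MulOpposite in
/-- A projection `M ⊗ N → T₂(A)` with suitably projective complement makes tensoring with `N` and
then with `M` compatible with kernels. -/
noncomputable def tensorFunctorCompIso (M : Type u) {P : Type u} [AddCommGroup M] [AddCommGroup P]
    [Module (lowerTriangular₂ k A) M] [Module (lowerTriangular₂ k B)ᵐᵒᵖ M]
    [SMulCommClass (lowerTriangular₂ k A) (lowerTriangular₂ k B)ᵐᵒᵖ M]
    [Module A M] [SMulCommClass A (lowerTriangular₂ k B)ᵐᵒᵖ M]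
    [IsScalarTower A (lowerTriangular₂ k A) M] [Module.Projective (lowerTriangular₂ k A) M]
    [Module.Projective (lowerTriangular₂ k B)ᵐᵒᵖ M]
    [Module (lowerTriangular₂ k A) P] [Module (lowerTriangular₂ k A)ᵐᵒᵖ P]
    [SMulCommClass (lowerTriangular₂ k A) (lowerTriangular₂ k A)ᵐᵒᵖ P]
    (θ : BalancedTensor (lowerTriangular₂ k B) M N ≃ₗ[lowerTriangular₂ k A]
      lowerTriangular₂ k A × P)
    (hθ : ∀ (c : lowerTriangular₂ k A) (m : M) (n : N),
      θ (BalancedTensor.tmul _ m (op c • n)) =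
        ((θ (BalancedTensor.tmul _ m n)).1 * c, op c • (θ (BalancedTensor.tmul _ m n)).2))
    (hP : ∀ (X : Type u) [AddCommGroup X] [Module (lowerTriangular₂ k A) X],
      Module.Projective (lowerTriangular₂ k A) (BalancedTensor (lowerTriangular₂ k A) P X)) :
    tensorFunctor (A := A) (B := B) N ⋙ tensorFunctor (A := B) (B := A) M ⋙ kernFunctor k A ≅
      kernFunctor k A :=
  NatIso.ofComponents
    (fun X => (BalancedTensor.kernEquivProjection (X := X.carrier) θ hθ hP).toModuleIso)
    fun f => ModuleCat.hom_ext <| LinearMap.ext fun t => Subtype.ext <|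
      LinearMap.congr_fun (BalancedTensor.projection_naturality θ hθ f) t.1

end DiagProjective

end LowerTriangular

namespace EnvelopingAlgebra

open MulOpposite TensorProduct

variable (k C D M : Type u) [Field k] [Ring C] [Ring D] [Algebra k C] [Algebra k D]
  [AddCommGroup M] [Module (C ⊗[k] Dᵐᵒᵖ) M]

/-- The left module underlying a module over an enveloping algebra. -/
noncomputable abbrev leftModule : Module C M :=
  Module.compHom M (Algebra.TensorProduct.includeLeftRingHom (R := k) (A := C) (B := Dᵐᵒᵖ))

/-- The right module underlying a module over an enveloping algebra. -/
noncomputable abbrev rightModule : Module Dᵐᵒᵖ M :=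
  Module.compHom M (Algebra.TensorProduct.includeRight (R := k) (A := C) (B := Dᵐᵒᵖ)).toRingHom

theorem smulCommClass :
    letI := leftModule k C D M
    letI := rightModule k C D M
    SMulCommClass C Dᵐᵒᵖ M :=
  letI := leftModule k C D M
  letI := rightModule k C D M
  ⟨fun c d m => by
    change (c ⊗ₜ[k] (1 : Dᵐᵒᵖ)) • (((1 : C) ⊗ₜ[k] d) • m) =
      ((1 : C) ⊗ₜ[k] d) • ((c ⊗ₜ[k] (1 : Dᵐᵒᵖ)) • m)
    rw [smul_smul, smul_smul, Algebra.TensorProduct.tmul_mul_tmul,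
      Algebra.TensorProduct.tmul_mul_tmul, mul_one, one_mul, mul_one, one_mul]⟩

variable {k C D M} {N P : Type u} [AddCommGroup N] [Module (D ⊗[k] Cᵐᵒᵖ) N] [AddCommGroup P]
  [Module (C ⊗[k] Cᵐᵒᵖ) P]

theorem exists_balancedTensor_linearEquiv (θ : OverTensor k C D C M N ≃+ C × P)
    (hleft : ∀ (c : C) (m : M) (n : N),
      θ (Submodule.Quotient.mk (((c ⊗ₜ[k] (1 : Dᵐᵒᵖ)) • m) ⊗ₜ[ℤ] n)) =
        (c * (θ (Submodule.Quotient.mk (m ⊗ₜ[ℤ] n))).1,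
          (c ⊗ₜ[k] (1 : Cᵐᵒᵖ)) • (θ (Submodule.Quotient.mk (m ⊗ₜ[ℤ] n))).2))
    (hright : ∀ (c : C) (m : M) (n : N),
      θ (Submodule.Quotient.mk (m ⊗ₜ[ℤ] (((1 : D) ⊗ₜ[k] op c) • n))) =
        ((θ (Submodule.Quotient.mk (m ⊗ₜ[ℤ] n))).1 * c,
          ((1 : C) ⊗ₜ[k] op c) • (θ (Submodule.Quotient.mk (m ⊗ₜ[ℤ] n))).2)) :
    letI := leftModule k C D M
    letI := rightModule k C D M
    letI := leftModule k D C N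
    letI := rightModule k D C N
    letI := leftModule k C C P
    letI := rightModule k C C P
    haveI := smulCommClass k C D M
    ∃ φ : BalancedTensor D M N ≃ₗ[C] C × P, ∀ (c : C) (m : M) (n : N),
      φ (BalancedTensor.tmul D m (op c • n)) =
        ((φ (BalancedTensor.tmul D m n)).1 * c, op c • (φ (BalancedTensor.tmul D m n)).2) := by
  let := leftModule k C D M
  let := rightModule k C D M
  let := leftModule k D C N
  let := rightModule k D C N
  let := leftModule k C C P
  let := rightModule k C C P
  have := smulCommClass k C D M
  let φ : BalancedTensor D M N ≃+ C × P := θ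
  have hφ : ∀ (c : C) (t : BalancedTensor D M N), φ (c • t) = c • φ t := fun c t => by
    induction t using BalancedTensor.induction_on with
    | zero => rw [smul_zero, map_zero, smul_zero]
    | tmul m n => exact hleft c m n
    | add s t hs ht => rw [smul_add, map_add, hs, ht, map_add, smul_add]
  exact ⟨φ.toLinearEquiv hφ, hright⟩

theorem projective_balancedTensor [Module.Projective (C ⊗[k] Cᵐᵒᵖ) P] (X : Type u) [AddCommGroup X]
    [Module C X] :
    letI := leftModule k C C P
    letI := rightModule k C C P
    haveI := smulCommClass k C C P
    Module.Projective C (BalancedTensor C P X) :=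
  letI := leftModule k C C P
  letI := rightModule k C C P
  haveI := smulCommClass k C C P
  BalancedTensor.projective_of_projective_bimodule k (fun _ _ => rfl) fun _ _ => rfl

end EnvelopingAlgebra

open CategoryTheory EnvelopingAlgebra LowerTriangular DiagProjective in
/-- A stable equivalence of Morita type between algebras of lower triangular matrices over
self-injective algebras induces an equivalence of the module categories of these algebras. -/
theorem IsStablyEquivalentOfMoritaType.nonempty_equivalence {k : Type u} [Field k] {A B : Type u}
    [Ring A] [Ring B] [Algebra k A] [Algebra k B]
    [FiniteDimensional k A] [FiniteDimensional k B] [Module.Injective A A] [Module.Injective B B]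
    (h : IsStablyEquivalentOfMoritaType k (lowerTriangular₂ k A) (lowerTriangular₂ k B)) :
    Nonempty (ModuleCat.{u} A ≌ ModuleCat.{u} B) := by
  obtain ⟨⟨M, N, P, Q, hM, hM', hN, hN', hP, hQ, θ, hθ, hθ', η, hη, hη'⟩⟩ := h
  let := leftModule k (lowerTriangular₂ k A) (lowerTriangular₂ k B) M
  let := rightModule k (lowerTriangular₂ k A) (lowerTriangular₂ k B) M
  have := smulCommClass k (lowerTriangular₂ k A) (lowerTriangular₂ k B) M
  let := leftModule k (lowerTriangular₂ k B) (lowerTriangular₂ k A) N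
  let := rightModule k (lowerTriangular₂ k B) (lowerTriangular₂ k A) N
  have := smulCommClass k (lowerTriangular₂ k B) (lowerTriangular₂ k A) N
  let := leftModule k (lowerTriangular₂ k A) (lowerTriangular₂ k A) P
  let := rightModule k (lowerTriangular₂ k A) (lowerTriangular₂ k A) P
  have := smulCommClass k (lowerTriangular₂ k A) (lowerTriangular₂ k A) P
  let := leftModule k (lowerTriangular₂ k B) (lowerTriangular₂ k B) Q
  let := rightModule k (lowerTriangular₂ k B) (lowerTriangular₂ k B) Q
  have := smulCommClass k (lowerTriangular₂ k B) (lowerTriangular₂ k B) Q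
  let := restrictDiag k A M
  have := isScalarTower_restrictDiag (k := k) (A := A) (X := M)
  have : SMulCommClass A (lowerTriangular₂ k B)ᵐᵒᵖ M := ⟨fun a => smul_comm (diag k a)⟩
  let := restrictDiag k B N
  have := isScalarTower_restrictDiag (k := k) (A := B) (X := N)
  have : SMulCommClass B (lowerTriangular₂ k A)ᵐᵒᵖ N := ⟨fun b => smul_comm (diag k b)⟩
  obtain ⟨φ, hφ⟩ := exists_balancedTensor_linearEquiv θ hθ hθ'
  obtain ⟨ψ, hψ⟩ := exists_balancedTensor_linearEquiv η hη hη'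
  exact Functor.nonempty_equivalence_of_full_of_essSurj (kernFunctor k A) (kernFunctor k B)
    (tensorFunctor N) (tensorFunctor M) (kernFunctor_map_tensorFunctor_map N)
    (kernFunctor_map_tensorFunctor_map M)
    (tensorFunctorCompIso N M φ hφ fun X _ _ => projective_balancedTensor (k := k) X)
    (tensorFunctorCompIso M N ψ hψ fun X _ _ => projective_balancedTensor (k := k) X)

/-- Let `A` and `B` be finite-dimensional self-injective `k`-algebras
with no semisimple direct factors.  If the lower triangular matrix algebras `T₂(A)` and
`T₂(B)` are stably equivalent of Morita type, then `A` and `B` are Morita equivalent,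
i.e. their module categories are equivalent. -/
theorem triangular_semt_implies_morita
    (k : Type u) [Field k] (A B : Type u) [Ring A] [Ring B] [Algebra k A] [Algebra k B]
    [FiniteDimensional k A] [FiniteDimensional k B]
    [Module.Injective A A] [Module.Injective B B]
    (hA : HasNoSemisimpleFactor A) (hB : HasNoSemisimpleFactor B)
    (h : IsStablyEquivalentOfMoritaType k (lowerTriangular₂ k A) (lowerTriangular₂ k B)) :
    Nonempty (ModuleCat.{u} A ≌ ModuleCat.{u} B) :=
  h.nonempty_equivalence
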